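/- arXiv:2411.09445 — 4 statements merged into one kernel-verified Lean document; each statement's English description precedes it below -/
import Mathlib

section
/- There exists a constant c < 1/8 such that g(n,7) ≤ c·2^n for every positive integer n. Equivalently, the limit γ_7 = lim_{n→∞} g(n,7)/2^n (which exists since g(n,7)/2^n is monotone increasing and bounded) is strictly less than 1/8. -/
/-- `G` is a `Q_d`-hitting set in `Q_n`: it meets the vertex set `{Y ∪ A : A ⊆ X}`
of every copy of `Q_d` in `Q_n` (given by `X` of size `d` and `Y` disjoint from `X`). -/
def IsHitting (n d : ℕ) (G : Finset (Finset (Fin n))) : Prop :=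
  ∀ X Y : Finset (Fin n), X.card = d → Disjoint X Y → ∃ A ⊆ X, Y ∪ A ∈ G

/-- `g n d` is the minimum size of a `Q_d`-hitting set in `Q_n`. -/
noncomputable def g (n d : ℕ) : ℕ :=
  sInf {k | ∃ G : Finset (Finset (Fin n)), IsHitting n d G ∧ G.card = k}

/-- If replacing `v a` by `v z` in the family `(v b)_{b ∈ B}` gives an independent family, then
`v a` has a nonzero coefficient in every expansion of `v z`. -/
lemma coeff_ne_zero_of_exchange {ι K V : Type*} [DecidableEq ι] [Field K] [AddCommGroup V]
    [Module K V] (v : ι → V) (B : Finset ι) (c : ι → K) {a z : ι} (hz : z ∉ B)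
    (hc : v z = ∑ b ∈ B, c b • v b)
    (hind : LinearIndepOn K v (insert z (B.erase a) : Finset ι)) : c a ≠ 0 := by
  intro h0
  rw [Finset.coe_insert, linearIndepOn_insert (by simp [hz])] at hind
  refine hind.2 (hc ▸ Submodule.sum_mem _ fun b hb => ?_)
  by_cases hba : b = a
  · simp [hba, h0]
  · exact Submodule.smul_mem _ _ (Submodule.subset_span ⟨b, by simp [hb, hba], rfl⟩)

/-- If replacing `v a`, `v a'` by `v z`, `v z'` in the family `(v b)_{b ∈ B}` gives an independent
family, then the corresponding `2 × 2` minor of the coefficients is nonzero. -/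
lemma minor_ne_zero_of_exchange {ι K V : Type*} [DecidableEq ι] [Field K] [AddCommGroup V]
    [Module K V] (v : ι → V) (B : Finset ι) (c c' : ι → K) {a a' z z' : ι}
    (hz : z ∉ B) (hzz : z ≠ z')
    (hc : v z = ∑ b ∈ B, c b • v b) (hc' : v z' = ∑ b ∈ B, c' b • v b) (hne : c' a ≠ 0)
    (hind : LinearIndepOn K v (insert z (insert z' ((B.erase a).erase a')) : Finset ι)) :
    c a * c' a' ≠ c a' * c' a := by
  intro h0
  rw [Finset.coe_insert, linearIndepOn_insert (by simp [hz, hzz])] at hind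
  have key : v z = (c a / c' a) • v z' + ∑ b ∈ B, (c b - c a / c' a * c' b) • v b := by
    simp only [hc, hc', sub_smul, Finset.sum_sub_distrib, mul_smul, Finset.smul_sum]
    abel
  refine hind.2 (key ▸ Submodule.add_mem _
    (Submodule.smul_mem _ _ (Submodule.subset_span ⟨z', by simp, rfl⟩))
    (Submodule.sum_mem _ fun b hb => ?_))
  by_cases hba : b = a
  · simp [hba, hne]
  by_cases hba' : b = a'
  · have : c a' - c a / c' a * c' a' = 0 := by
      field_simp
      linear_combination -h0
    simp [hba', this]
  · exact Submodule.smul_mem _ _ (Submodule.subset_span ⟨b, by simp [hb, hba, hba'], rfl⟩)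

/-- At least `|K|` nonzero ratios in a finite field `K` cannot be pairwise distinct. -/
lemma exists_ratio_eq {ι K : Type*} [Field K] [Finite K] (A : Finset ι)
    (hA : Nat.card K ≤ A.card) (f f' : ι → K)
    (hf : ∀ a ∈ A, f a ≠ 0) (hf' : ∀ a ∈ A, f' a ≠ 0) :
    ∃ a ∈ A, ∃ a' ∈ A, a ≠ a' ∧ f a * f' a' = f a' * f' a := by
  classical
  have := Fintype.ofFinite K
  obtain ⟨a, ha, a', ha', hne, h⟩ := Finset.exists_ne_map_eq_of_card_lt_of_maps_to
    (s := A) (t := Finset.univ.erase (0 : K)) (f := fun a => f a / f' a)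
    (by
      rw [Finset.card_erase_of_mem (Finset.mem_univ _), Finset.card_univ,
        ← Nat.card_eq_fintype_card]
      have := Nat.card_pos (α := K)
      omega)
    (fun a ha => by simp [hf a ha, hf' a ha])
  refine ⟨a, ha, a', ha', hne, ?_⟩
  rwa [div_eq_div_iff (hf' a ha) (hf' a' ha')] at h

/-- Among the sets `Y ∪ A` of size `r` with `A ⊆ X`, some set indexes a dependent family in `K ^ r`:
otherwise there would be an MDS code over `K` that is too long. -/
lemma exists_not_linearIndepOn {ι K : Type*} [DecidableEq ι] [Field K] [Finite K] {r : ℕ}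
    (v : ι → Fin r → K) {X Y A₀ : Finset ι} (hXY : Disjoint X Y) (hA₀ : A₀ ⊆ X)
    (hr : (Y ∪ A₀).card = r) (h2 : 2 ≤ A₀.card) (h2' : 2 ≤ (X \ A₀).card)
    (hq : Nat.card K ≤ A₀.card ∨ Nat.card K ≤ (X \ A₀).card) :
    ∃ A ⊆ X, (Y ∪ A).card = r ∧ ¬ LinearIndepOn K v (Y ∪ A : Finset ι) := by
  by_contra! hall
  set B := Y ∪ A₀ with hB
  have hBind : LinearIndepOn K v (B : Finset ι) := hall A₀ hA₀ hr
  have hspan : Submodule.span K (v '' (B : Set ι)) = ⊤ := by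
    have := LinearIndependent.span_eq_top_of_card_eq_finrank' (K := K) hBind (by simp [hr])
    rwa [Set.image_eq_range]
  have hcoeff : ∀ z, ∃ c : ι → K, v z = ∑ b ∈ B, c b • v b := fun z => by
    have hz : v z ∈ Submodule.span K (v '' (B : Set ι)) := hspan ▸ Submodule.mem_top
    obtain ⟨c, hc⟩ := (Submodule.mem_span_image_finset_iff_exists_fun K).1 hz
    refine ⟨fun b => if h : b ∈ B then c ⟨b, h⟩ else 0, ?_⟩
    rw [← hc, ← Finset.sum_coe_sort B]
    simp
  choose c hc using hcoeff
  have hzB : ∀ z ∈ X \ A₀, z ∉ B := fun z hz => by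
    rw [Finset.mem_sdiff] at hz
    simp [hB, hz.2, Finset.disjoint_left.1 hXY hz.1]
  have haY : ∀ a ∈ A₀, a ∉ Y := fun a ha => Finset.disjoint_left.1 hXY (hA₀ ha)
  have hentry : ∀ z ∈ X \ A₀, ∀ a ∈ A₀, c z a ≠ 0 := fun z hz a ha => by
    have haB : a ∈ B := Finset.mem_union_right _ ha
    have heq : Y ∪ insert z (A₀.erase a) = insert z (B.erase a) := by
      rw [Finset.union_insert, hB, Finset.erase_union_distrib, Finset.erase_eq_of_notMem (haY a ha)]
    have hcard : (insert z (B.erase a)).card = r := by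
      rw [Finset.card_insert_of_notMem (by simp [hzB z hz]), Finset.card_erase_add_one haB, hr]
    have hsub : insert z (A₀.erase a) ⊆ X :=
      Finset.insert_subset (Finset.mem_sdiff.1 hz).1 ((Finset.erase_subset _ _).trans hA₀)
    have := hall _ hsub (heq ▸ hcard)
    rw [heq] at this
    exact coeff_ne_zero_of_exchange v B (c z) (hzB z hz) (hc z) this
  have hminor : ∀ z ∈ X \ A₀, ∀ z' ∈ X \ A₀, z ≠ z' → ∀ a ∈ A₀, ∀ a' ∈ A₀, a ≠ a' →
      c z a * c z' a' ≠ c z a' * c z' a := fun z hz z' hz' hzz a ha a' ha' haa => by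
    have haB : a ∈ B := Finset.mem_union_right _ ha
    have haB' : a' ∈ B.erase a := Finset.mem_erase.2 ⟨haa.symm, Finset.mem_union_right _ ha'⟩
    have heq : Y ∪ insert z (insert z' ((A₀.erase a).erase a')) =
        insert z (insert z' ((B.erase a).erase a')) := by
      rw [Finset.union_insert, Finset.union_insert, hB, Finset.erase_union_distrib,
        Finset.erase_eq_of_notMem (haY a ha), Finset.erase_union_distrib,
        Finset.erase_eq_of_notMem (haY a' ha')]
    have hcard : (insert z (insert z' ((B.erase a).erase a'))).card = r := by
      rw [Finset.card_insert_of_notMem (by simp [hzB z hz, hzz]),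
        Finset.card_insert_of_notMem (by simp [hzB z' hz']), Finset.card_erase_add_one haB',
        Finset.card_erase_add_one haB, hr]
    have hsub : insert z (insert z' ((A₀.erase a).erase a')) ⊆ X :=
      Finset.insert_subset (Finset.mem_sdiff.1 hz).1 (Finset.insert_subset
        (Finset.mem_sdiff.1 hz').1 ((Finset.erase_subset _ _).trans ((Finset.erase_subset _ _).trans hA₀)))
    have := hall _ hsub (heq ▸ hcard)
    rw [heq] at this
    exact minor_ne_zero_of_exchange v B (c z) (c z') (hzB z hz) hzz (hc z) (hc z')
      (hentry z' hz' a ha) this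
  rcases hq with hq | hq
  · obtain ⟨z, hz, z', hz', hzz⟩ := Finset.one_lt_card.1 h2'
    obtain ⟨a, ha, a', ha', haa, h⟩ :=
      exists_ratio_eq A₀ hq (c z) (c z') (hentry z hz) (hentry z' hz')
    exact hminor z hz z' hz' hzz a ha a' ha' haa h
  · obtain ⟨a, ha, a', ha', haa⟩ := Finset.one_lt_card.1 h2
    obtain ⟨z, hz, z', hz', hzz, h⟩ :=
      exists_ratio_eq (X \ A₀) hq (fun z => c z a) (fun z => c z a')
        (fun z hz => hentry z hz a ha) (fun z hz => hentry z hz a' ha')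
    exact hminor z hz z' hz' hzz a ha a' ha' haa (by rw [h, mul_comm])

lemma card_ker_mul_card {K V W : Type*} [Field K] [AddCommGroup V] [Module K V] [AddCommGroup W]
    [Module K W] (L : V →ₗ[K] W) (hL : Function.Surjective L) :
    Nat.card {v // L v = 0} * Nat.card W = Nat.card V := by
  rw [Submodule.card_eq_card_quotient_mul_card (LinearMap.ker L),
    Nat.card_congr (L.quotKerEquivOfSurjective hL).toEquiv]
  rfl

/-- A uniformly random family of `|S|` vectors in `K ^ |S|` is dependent with probability at most
`1 / (|K| - 1)`. -/
lemma card_not_linearIndepOn_le {ι K : Type*} [Fintype ι] [DecidableEq ι] [Field K] [Finite K]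
    (S : Finset ι) :
    (Nat.card K - 1) * Nat.card {v : ι → Fin S.card → K // ¬ LinearIndepOn K v S} ≤
      Nat.card (ι → Fin S.card → K) := by
  classical
  have := Fintype.ofFinite K
  set r := S.card with hr
  let L : (S → K) → (ι → Fin r → K) →ₗ[K] (Fin r → K) := fun c =>
    ∑ i : S, c i • LinearMap.proj (i : ι)
  have hLapp : ∀ c v, L c v = ∑ i : S, c i • v i := fun c v => by
    simp [L, LinearMap.sum_apply]
  have hsurj : ∀ c ≠ 0, Function.Surjective (L c) := fun c hc w => by
    obtain ⟨i, hi⟩ := Function.ne_iff.1 hc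
    refine ⟨Pi.single (i : ι) ((c i)⁻¹ • w), ?_⟩
    rw [hLapp, Finset.sum_eq_single i]
    · simp [smul_smul, mul_inv_cancel₀ hi]
    · intro j _ hj
      rw [Pi.single_eq_of_ne (fun h => hj (Subtype.ext h)), smul_zero]
    · simp
  let P := {p : {c : S → K // c ≠ 0} × (ι → Fin r → K) // L p.1 p.2 = 0}
  have hlower : (Nat.card K - 1) * Nat.card {v : ι → Fin r → K // ¬ LinearIndepOn K v S} ≤
      Nat.card P := by
    have hex : ∀ v : {v : ι → Fin r → K // ¬ LinearIndepOn K v S},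
        ∃ c : S → K, c ≠ 0 ∧ L c v.1 = 0 := fun v => by
      obtain ⟨c, hc, i, hi⟩ := Fintype.not_linearIndependent_iff.1 v.2
      exact ⟨c, fun h => hi (by simp [h]), by rw [hLapp]; exact hc⟩
    choose c hc hc0 using hex
    rw [← Nat.card_units, ← Nat.card_prod]
    refine Nat.card_le_card_of_injective
      (fun p : Kˣ × _ => (⟨(⟨(p.1 : K) • c p.2, smul_ne_zero p.1.ne_zero (hc p.2)⟩, p.2.1), ?_⟩ : P))
      ?_
    · have := hc0 p.2
      rw [hLapp] at this ⊢
      simpa [mul_smul, ← Finset.smul_sum] using this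
    · rintro ⟨u, v⟩ ⟨u', v'⟩ h
      simp only [P, Subtype.mk.injEq, Prod.mk.injEq] at h
      obtain rfl : v = v' := Subtype.ext h.2
      simpa [Units.ext_iff] using smul_left_injective K (hc v) h.1
  have hupper : Nat.card P ≤ Nat.card (ι → Fin r → K) := by
    let e : P ≃ Σ c : {c : S → K // c ≠ 0}, {v // L c.1 v = 0} :=
      { toFun p := ⟨p.1.1, p.1.2, p.2⟩
        invFun p := ⟨(p.1, p.2.1), p.2.2⟩
        left_inv _ := rfl
        right_inv _ := rfl }
    have hpos : 0 < Nat.card (Fin r → K) := Nat.card_pos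
    refine Nat.le_of_mul_le_mul_right ?_ hpos
    rw [Nat.card_congr e, Nat.card_sigma, Finset.sum_mul,
      Finset.sum_congr rfl fun (c : {c : S → K // c ≠ 0}) _ =>
        card_ker_mul_card (L c.1) (hsurj c.1 c.2),
      Finset.sum_const, smul_eq_mul, mul_comm]
    refine Nat.mul_le_mul_left _ ?_
    rw [Finset.card_univ, ← Nat.card_eq_fintype_card]
    refine (Nat.card_le_card_of_injective _ Subtype.val_injective).trans_eq ?_
    simp [hr]
  exact hlower.trans hupper

open Classical in
lemma exists_few_not_linearIndepOn (K : Type*) [Field K] [Finite K] (n r : ℕ) :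
    ∃ v : Fin n → Fin r → K, (Nat.card K - 1) *
      ((Finset.univ.powersetCard r).filter fun S : Finset (Fin n) =>
        ¬ LinearIndepOn K v S).card ≤ n.choose r := by
  have := Fintype.ofFinite K
  obtain ⟨v, -, hv⟩ := Finset.exists_le_of_sum_le
    (s := (Finset.univ : Finset (Fin n → Fin r → K)))
    (f := fun v => (Nat.card K - 1) * ((Finset.univ.powersetCard r).filter
      fun S : Finset (Fin n) => ¬ LinearIndepOn K v S).card)
    (g := fun _ => n.choose r) Finset.univ_nonempty (by
      simp only [Finset.card_filter]
      rw [← Finset.mul_sum, Finset.sum_comm, Finset.mul_sum]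
      calc _ ≤ ∑ S ∈ Finset.univ.powersetCard r, Fintype.card (Fin n → Fin r → K) := by
            refine Finset.sum_le_sum fun S hS => ?_
            obtain rfl := (Finset.mem_powersetCard.1 hS).2
            have := card_not_linearIndepOn_le (K := K) S
            rwa [Nat.card_eq_fintype_card (α := Fin n → _), Nat.card_eq_fintype_card (α := Subtype _),
              Fintype.card_subtype, Finset.card_filter] at this
        _ = _ := by simp [mul_comm])
  exact ⟨v, hv⟩

/-- The dependent sets in the layers of `Q_n` of a suitable residue modulo `4`, for a suitable
assignment of vectors over the field with four elements, form a small `Q_7`-hitting set. -/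
lemma exists_small_hitting (n : ℕ) :
    ∃ G : Finset (Finset (Fin n)), IsHitting n 7 G ∧ 12 * G.card ≤ 2 ^ n := by
  classical
  let K := GaloisField 2 2
  have hK : Nat.card K = 4 := GaloisField.card 2 2 (by norm_num)
  have : Finite K := Nat.finite_of_card_ne_zero (by omega)
  choose v hv using exists_few_not_linearIndepOn K n
  rw [hK] at hv
  let D : Finset (Finset (Fin n)) :=
    Finset.univ.filter fun S => ¬ LinearIndepOn K (v S.card) S
  have hD : 3 * D.card ≤ 2 ^ n := by
    rw [Finset.card_eq_sum_card_fiberwise (f := Finset.card) (t := Finset.range (n + 1))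
      (fun S _ => by simpa [Nat.lt_succ_iff] using S.card_le_univ), Finset.mul_sum,
      ← Nat.sum_range_choose]
    refine Finset.sum_le_sum fun r _ => (Nat.mul_le_mul_left 3 ?_).trans (hv r)
    refine Finset.card_le_card fun S hS => ?_
    simp only [D, Finset.mem_filter, Finset.mem_univ, true_and] at hS
    obtain ⟨hS, rfl⟩ := hS
    simpa [Finset.mem_powersetCard] using hS
  obtain ⟨a, ha, hcard⟩ := Finset.exists_le_of_sum_le (s := Finset.range 4)
    (f := fun a => 12 * (D.filter fun S => S.card % 4 = a).card) (g := fun _ => 2 ^ n) (by simp) (by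
      have := Finset.card_eq_sum_card_fiberwise (s := D) (t := Finset.range 4)
        (f := fun S => S.card % 4) (fun S _ => by simpa using Nat.mod_lt _ (by norm_num))
      rw [← Finset.mul_sum, ← this, Finset.sum_const, Finset.card_range, smul_eq_mul]
      omega)
  refine ⟨_, fun X Y hX hXY => ?_, hcard⟩
  obtain ⟨t, ht2, ht5, ht⟩ : ∃ t, 2 ≤ t ∧ t ≤ 5 ∧ (Y.card + t) % 4 = a := by
    rw [Finset.mem_range] at ha
    exact ⟨2 + (a + 4 - (Y.card + 2) % 4) % 4, by omega, by omega, by omega⟩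
  obtain ⟨A₀, hA₀, rfl⟩ := Finset.exists_subset_card_eq (s := X) (n := t) (by omega)
  have hcX : (X \ A₀).card = 7 - A₀.card := by rw [Finset.card_sdiff_of_subset hA₀, hX]
  have hr : (Y ∪ A₀).card = Y.card + A₀.card :=
    Finset.card_union_of_disjoint (hXY.symm.mono_right hA₀)
  obtain ⟨A, hA, hAr, hdep⟩ := exists_not_linearIndepOn (v (Y.card + A₀.card)) hXY hA₀ hr
    ht2 (by omega) (by omega)
  refine ⟨A, hA, ?_⟩
  simp only [D, Finset.mem_filter, Finset.mem_univ, true_and]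
  rw [hAr]
  exact ⟨hdep, ht⟩

/-- There is a constant `c < 1/8` such that `g(n,7) ≤ c·2^n` for every positive integer `n`;
in particular `γ_7 < 1/8`. -/
theorem turan_density_Q7 :
    ∃ c : ℝ, c < 1 / 8 ∧ ∀ n : ℕ, 0 < n → (g n 7 : ℝ) ≤ c * 2 ^ n := by
  refine ⟨1 / 12, by norm_num, fun n _ => ?_⟩
  obtain ⟨G, hG, hcard⟩ := exists_small_hitting n
  have hle : g n 7 ≤ G.card := Nat.sInf_le ⟨G, hG, rfl⟩
  have h : (12 * g n 7 : ℝ) ≤ 2 ^ n := by exact_mod_cast (Nat.mul_le_mul_left 12 hle).trans hcard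
  linarith
end

section
/- There exists a constant c < 1/7 such that g(n,6) ≤ c·2^n for every positive integer n. Equivalently, the limit γ_6 = lim_{n→∞} g(n,6)/2^n (which exists since g(n,6)/2^n is monotone increasing and bounded) is strictly less than 1/7. -/
open Finset

/-- The rank of the vectors `f i`, `i ∈ S`. -/
noncomputable def familyRank (K : Type*) {ι V : Type*} [Field K] [AddCommGroup V] [Module K V]
    (f : ι → V) (S : Finset ι) : ℕ :=
  Module.finrank K (Submodule.span K (f '' (S : Set ι)))

section FamilyRank

variable {K ι V : Type*} [Field K] [AddCommGroup V] [Module K V]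

lemma familyRank_le_card [DecidableEq V] (f : ι → V) (S : Finset ι) : familyRank K f S ≤ #S := by
  unfold familyRank
  rw [← Finset.coe_image]
  exact (finrank_span_finset_le_card _).trans Finset.card_image_le

lemma familyRank_insert_of_mem [DecidableEq ι] {f : ι → V} {S : Finset ι} {x : ι}
    (hx : f x ∈ Submodule.span K (f '' (S : Set ι))) :
    familyRank K f (insert x S) = familyRank K f S := by
  unfold familyRank
  rw [Finset.coe_insert, Set.image_insert_eq, Submodule.span_insert_eq_span hx]

variable [FiniteDimensional K V]

lemma familyRank_le_finrank (f : ι → V) (S : Finset ι) :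
    familyRank K f S ≤ Module.finrank K V :=
  Submodule.finrank_le _

lemma familyRank_mono (f : ι → V) {S T : Finset ι} (h : S ⊆ T) :
    familyRank K f S ≤ familyRank K f T :=
  Submodule.finrank_mono (Submodule.span_mono (Set.image_mono (by exact_mod_cast h)))

lemma finrank_span_insert_of_notMem {s : Set V} {x : V} (hx : x ∉ Submodule.span K s) :
    Module.finrank K (Submodule.span K (insert x s)) =
      Module.finrank K (Submodule.span K s) + 1 := by
  have hx0 : x ≠ 0 := by rintro rfl; exact hx (Submodule.zero_mem _)
  have hd : Submodule.span K {x} ⊓ Submodule.span K s = ⊥ := by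
    rw [← disjoint_iff, Submodule.disjoint_span_singleton' hx0 |> disjoint_comm.trans]
    exact hx
  have h := Submodule.finrank_sup_add_finrank_inf_eq (Submodule.span K {x}) (Submodule.span K s)
  rw [hd, finrank_bot, finrank_span_singleton hx0] at h
  rw [Submodule.span_insert]
  omega

lemma familyRank_insert_of_notMem [DecidableEq ι] {f : ι → V} {S : Finset ι} {x : ι}
    (hx : f x ∉ Submodule.span K (f '' (S : Set ι))) :
    familyRank K f (insert x S) = familyRank K f S + 1 := by
  unfold familyRank
  rw [Finset.coe_insert, Set.image_insert_eq, finrank_span_insert_of_notMem hx]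

lemma familyRank_insert_le [DecidableEq ι] (f : ι → V) (S : Finset ι) (x : ι) :
    familyRank K f (insert x S) ≤ familyRank K f S + 1 := by
  by_cases hx : f x ∈ Submodule.span K (f '' (S : Set ι))
  · rw [familyRank_insert_of_mem hx]; omega
  · rw [familyRank_insert_of_notMem hx]

lemma familyRank_le_erase [DecidableEq ι] (f : ι → V) (S : Finset ι) (x : ι) :
    familyRank K f S ≤ familyRank K f (S.erase x) + 1 :=
  (familyRank_mono f (Finset.insert_erase_subset x S)).trans (familyRank_insert_le f _ x)

/-- Greedy extension of `Y` by at most `k` elements of `X`. -/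
lemma exists_subset_le_familyRank_union [DecidableEq ι] (f : ι → V) (X Y : Finset ι) (k m : ℕ)
    (hk : m ≤ familyRank K f Y + k) (hm : m ≤ familyRank K f (Y ∪ X)) :
    ∃ A ⊆ X, #A ≤ k ∧ m ≤ familyRank K f (Y ∪ A) := by
  induction k generalizing m with
  | zero => exact ⟨∅, by simp, by simp, by simpa using hk⟩
  | succ k ih =>
    obtain ⟨A, hAX, hA, hmA⟩ := ih (m - 1) (by omega) (by omega)
    by_cases h : m ≤ familyRank K f (Y ∪ A)
    · exact ⟨A, hAX, by omega, h⟩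
    obtain ⟨x, hx, hxs⟩ : ∃ x ∈ X, f x ∉ Submodule.span K (f '' ((Y ∪ A : Finset ι) : Set ι)) := by
      by_contra! hcon
      have hle : Submodule.span K (f '' ((Y ∪ X : Finset ι) : Set ι)) ≤
          Submodule.span K (f '' ((Y ∪ A : Finset ι) : Set ι)) := by
        rw [Submodule.span_le]
        rintro _ ⟨i, hi, rfl⟩
        rcases Finset.mem_union.1 (Finset.mem_coe.1 hi) with hi | hi
        · exact Submodule.subset_span ⟨i, by simp [hi], rfl⟩
        · exact hcon i hi
      have := Submodule.finrank_mono hle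
      unfold familyRank at h hm
      omega
    refine ⟨insert x A, Finset.insert_subset hx hAX, (Finset.card_insert_le _ _).trans (by omega), ?_⟩
    rw [Finset.union_insert, familyRank_insert_of_notMem hxs]
    omega

end FamilyRank

lemma exists_ne_mul_eq_mul_zmod_three (p q : Fin 3 → ZMod 3) (hp : ∀ i, p i ≠ 0)
    (hq : ∀ i, q i ≠ 0) : ∃ i j, i ≠ j ∧ p i * q j = q i * p j := by
  have key : ∀ a b : ZMod 3, a ≠ 0 → b ≠ 0 → a ≠ b → a = -b := by decide
  obtain ⟨i, j, hij, h⟩ := Fintype.exists_ne_map_eq_of_card_lt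
    (fun i => decide (p i = q i)) (by simp)
  refine ⟨i, j, hij, ?_⟩
  rw [decide_eq_decide] at h
  by_cases hi : p i = q i
  · rw [hi, h.1 hi]
  · rw [key _ _ (hp i) (hq i) hi, key _ _ (hp j) (hq j) (mt h.2 hi), neg_mul, mul_neg]

lemma exists_fin_three_injective {ι : Type*} {A : Finset ι} (h : 3 ≤ #A) :
    ∃ e : Fin 3 → ι, Function.Injective e ∧ ∀ i, e i ∈ A :=
  ⟨fun i => A.equivFin.symm (Fin.castLE h i),
    Subtype.val_injective.comp (A.equivFin.symm.injective.comp (Fin.castLE_injective h)),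
    fun i => (A.equivFin.symm (Fin.castLE h i)).2⟩

section Ternary

variable {ι V : Type*} [DecidableEq ι] [AddCommGroup V] [Module (ZMod 3) V]
  [FiniteDimensional (ZMod 3) V]

/-- Ternary matroids have no uniform minor of rank `2`, `3` or `4` on six elements. More precisely,
if some `Y ∪ A` is a basis, then some `Y ∪ A'` has corank exactly one. -/
lemma exists_corank_one_of_basis (f : ι → V) {X Y A : Finset ι} (hXY : Disjoint X Y)
    (hX : #X = 6) (hAX : A ⊆ X) (hA2 : 2 ≤ #A) (hA4 : #A ≤ 4)
    (hr : #Y + #A = Module.finrank (ZMod 3) V)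
    (hrk : familyRank (ZMod 3) f (Y ∪ A) = Module.finrank (ZMod 3) V) :
    ∃ A' ⊆ X, #A' = #A ∧
      familyRank (ZMod 3) f (Y ∪ A') + 1 = Module.finrank (ZMod 3) V := by
  classical
  by_contra! hno
  have swap : ∀ A' ⊆ X, #A' = #A →
      familyRank (ZMod 3) f (Y ∪ A') = Module.finrank (ZMod 3) V →
      ∀ a ∈ A', ∀ x ∈ X, x ∉ A' →
      familyRank (ZMod 3) f (Y ∪ insert x (A'.erase a)) = Module.finrank (ZMod 3) V := by
    intro A' hA'X hA' hrk' a ha x hx hxA'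
    have hc : #(insert x (A'.erase a)) = #A := by
      rw [Finset.card_insert_of_notMem (by simp [hxA']), Finset.card_erase_add_one ha, hA']
    have hs : insert x (A'.erase a) ⊆ X :=
      Finset.insert_subset hx ((Finset.erase_subset _ _).trans hA'X)
    have h1 := hno _ hs hc
    have h2 := familyRank_le_finrank (K := ZMod 3) f (Y ∪ insert x (A'.erase a))
    have h3 := familyRank_le_erase (K := ZMod 3) f (Y ∪ A') a
    have h4 : familyRank (ZMod 3) f ((Y ∪ A').erase a) ≤
        familyRank (ZMod 3) f (Y ∪ insert x (A'.erase a)) := by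
      apply familyRank_mono
      intro i
      simp only [Finset.mem_erase, Finset.mem_union, Finset.mem_insert]
      tauto
    omega
  have htop : Submodule.span (ZMod 3) (f '' ((Y ∪ A : Finset ι) : Set ι)) = ⊤ :=
    Submodule.eq_top_of_finrank_eq hrk
  have hrep : ∀ x, ∃ c : ι → ZMod 3, ∑ i ∈ Y ∪ A, c i • f i = f x := by
    intro x
    have hx : f x ∈ Submodule.span (ZMod 3) (f '' ((Y ∪ A : Finset ι) : Set ι)) := by
      rw [htop]; trivial
    exact (Submodule.mem_span_image_finset_iff_exists_fun' _).1 hx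
  choose c hc using hrep
  have hlt : ∀ S : Finset ι, #S < Module.finrank (ZMod 3) V →
      familyRank (ZMod 3) f S ≠ Module.finrank (ZMod 3) V := by
    intro S hS
    have := familyRank_le_card (K := ZMod 3) f S
    omega
  have hYA : Disjoint Y A := (Finset.disjoint_of_subset_left hAX hXY).symm
  have hcard : #(Y ∪ A) = Module.finrank (ZMod 3) V := by
    rw [Finset.card_union_of_disjoint hYA, hr]
  have hnz : ∀ a ∈ A, ∀ x ∈ X, x ∉ A → c x a ≠ 0 := by
    intro a ha x hx hxA h0
    have haY : a ∉ Y := fun h => Finset.disjoint_left.1 hYA h ha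
    have hsw := swap A hAX rfl hrk a ha x hx hxA
    have hset : Y ∪ insert x (A.erase a) = insert x ((Y ∪ A).erase a) := by
      rw [Finset.union_insert, Finset.erase_union_distrib, Finset.erase_eq_of_notMem haY]
    rw [hset, familyRank_insert_of_mem] at hsw
    · exact hlt _ (by rw [Finset.card_erase_of_mem (by simp [ha])]; omega) hsw
    · rw [← hc x, ← Finset.add_sum_erase _ _ (show a ∈ Y ∪ A by simp [ha]), h0, zero_smul,
        zero_add]
      exact Submodule.sum_mem _ fun i hi =>
        Submodule.smul_mem _ _ (Submodule.subset_span ⟨i, hi, rfl⟩)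
  have hminor : ∀ a ∈ A, ∀ b ∈ A, a ≠ b → ∀ x ∈ X, x ∉ A → ∀ y ∈ X, y ∉ A → x ≠ y →
      c x a * c y b ≠ c x b * c y a := by
    intro a ha b hb hab x hx hxA y hy hyA hxy h0
    have haY : a ∉ Y := fun h => Finset.disjoint_left.1 hYA h ha
    have hbY : b ∉ Y := fun h => Finset.disjoint_left.1 hYA h hb
    have hsw1 := swap A hAX rfl hrk a ha y hy hyA
    have hsw := swap (insert y (A.erase a))
      (Finset.insert_subset hy ((Finset.erase_subset _ _).trans hAX))
      (by rw [Finset.card_insert_of_notMem (by simp [hyA]), Finset.card_erase_add_one ha])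
      hsw1 b (by simp [hb, hab.symm]) x hx (by simp [hxA, hxy])
    have hyb : y ≠ b := by rintro rfl; exact hyA hb
    have hset : Y ∪ insert x ((insert y (A.erase a)).erase b) =
        insert x (insert y (((Y ∪ A).erase a).erase b)) := by
      rw [Finset.erase_insert_of_ne hyb, Finset.union_insert, Finset.union_insert,
        Finset.erase_union_distrib, Finset.erase_union_distrib, Finset.erase_eq_of_notMem haY,
        Finset.erase_eq_of_notMem hbY]
    have hb' : b ∈ (Y ∪ A).erase a := by simp [hb, hab.symm]
    rw [hset, familyRank_insert_of_mem] at hsw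
    · refine hlt _ ((Finset.card_insert_le _ _).trans_lt ?_) hsw
      rw [Finset.card_erase_of_mem hb', Finset.card_erase_of_mem (by simp [ha])]
      omega
    · have hsum : ∑ i ∈ Y ∪ A, (c y a * c x i - c x a * c y i) • f i =
          c y a • f x - c x a • f y := by
        rw [← hc x, ← hc y, Finset.smul_sum, Finset.smul_sum, ← Finset.sum_sub_distrib]
        simp only [sub_smul, mul_smul]
      rw [← Finset.add_sum_erase _ _ (show a ∈ Y ∪ A by simp [ha]),
        ← Finset.add_sum_erase _ _ hb',
        show c y a * c x a - c x a * c y a = 0 by ring,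
        show c y a * c x b - c x a * c y b = 0 by rw [h0]; ring, zero_smul, zero_smul, zero_add,
        zero_add] at hsum
      have hne := hnz a ha y hy hyA
      have hfx : f x = (c y a)⁻¹ • (∑ i ∈ ((Y ∪ A).erase a).erase b,
          (c y a * c x i - c x a * c y i) • f i + c x a • f y) := by
        rw [hsum, sub_add_cancel, inv_smul_smul₀ hne]
      rw [hfx]
      refine Submodule.smul_mem _ _ (Submodule.add_mem _ (Submodule.sum_mem _ fun i hi =>
        Submodule.smul_mem _ _ (Submodule.subset_span ⟨i, ?_, rfl⟩))
        (Submodule.smul_mem _ _ (Submodule.subset_span ⟨y, by simp, rfl⟩)))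
      exact Finset.mem_coe.2 (Finset.mem_insert_of_mem hi)
  have hXA : #(X \ A) = 6 - #A := by rw [Finset.card_sdiff_of_subset hAX, hX]
  rcases Nat.lt_or_ge 3 #A with h3 | h3
  · obtain ⟨a, hinj, ha⟩ := exists_fin_three_injective (by omega : 3 ≤ #A)
    obtain ⟨x, hx, y, hy, hxy⟩ := Finset.one_lt_card.1 (by omega : 1 < #(X \ A))
    rw [Finset.mem_sdiff] at hx hy
    obtain ⟨i, j, hij, h⟩ := exists_ne_mul_eq_mul_zmod_three (fun i => c x (a i))
      (fun i => c y (a i)) (fun i => hnz _ (ha i) x hx.1 hx.2)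
      (fun i => hnz _ (ha i) y hy.1 hy.2)
    exact hminor _ (ha i) _ (ha j) (hinj.ne hij) x hx.1 hx.2 y hy.1 hy.2 hxy
      (by rw [h, mul_comm])
  · obtain ⟨x, hinj, hx⟩ := exists_fin_three_injective (by omega : 3 ≤ #(X \ A))
    obtain ⟨a, ha, b, hb, hab⟩ := Finset.one_lt_card.1 (by omega : 1 < #A)
    simp only [Finset.mem_sdiff] at hx
    obtain ⟨i, j, hij, h⟩ := exists_ne_mul_eq_mul_zmod_three (fun i => c (x i) a)
      (fun i => c (x i) b) (fun i => hnz a ha _ (hx i).1 (hx i).2)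
      (fun i => hnz b hb _ (hx i).1 (hx i).2)
    exact hminor a ha b hb hab _ (hx i).1 (hx i).2 _ (hx j).1 (hx j).2 (hinj.ne hij) h

lemma exists_corank_one_or_deficient (f : ι → V) {X Y : Finset ι} (hXY : Disjoint X Y)
    (hX : #X = 6) {t : ℕ} (ht2 : 2 ≤ t) (ht4 : t ≤ 4)
    (hr : #Y + t = Module.finrank (ZMod 3) V) :
    (∃ A ⊆ X, #A = t ∧ familyRank (ZMod 3) f (Y ∪ A) + 1 = Module.finrank (ZMod 3) V) ∨
      familyRank (ZMod 3) f Y + 2 ≤ #Y ∨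
      familyRank (ZMod 3) f (Y ∪ X) + 2 ≤ Module.finrank (ZMod 3) V := by
  by_contra! h
  obtain ⟨hno, hY, hYX⟩ := h
  obtain ⟨A₀, hA₀X, hA₀, hrk₀⟩ := exists_subset_le_familyRank_union (K := ZMod 3) f X Y t
    (Module.finrank (ZMod 3) V - 1) (by omega) (by omega)
  obtain ⟨A, hA₀A, hAX, hA⟩ := Finset.exists_subsuperset_card_eq hA₀X hA₀ (by omega)
  have h1 := familyRank_mono (K := ZMod 3) f (Finset.union_subset_union_right hA₀A : Y ∪ A₀ ⊆ Y ∪ A)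
  have h2 := familyRank_le_finrank (K := ZMod 3) f (Y ∪ A)
  have h3 := hno A hAX hA
  obtain ⟨A', hA'X, hA', hrk'⟩ := exists_corank_one_of_basis f hXY hX hAX (by omega) (by omega)
    (by omega) (by omega)
  exact hno A' hA'X (by omega) hrk'

end Ternary

section Counting

variable {K V : Type*} [Field K] [Fintype K] [AddCommGroup V] [Module K V] [Fintype V]

/-- Adding a uniformly random vector to a random tuple: it lies in the span of the previous
vectors with probability `|K| ^ ρ / |V|`, where `ρ` is their rank. -/
lemma sum_finrank_range_succ (φ : ℕ → ℝ) (k : ℕ) :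
    ∑ v : Fin (k + 1) → V, φ ((Set.range v).finrank K) =
      ∑ v : Fin k → V, ((Fintype.card K : ℝ) ^ (Set.range v).finrank K *
          φ ((Set.range v).finrank K) +
        ((Fintype.card V : ℝ) - (Fintype.card K : ℝ) ^ (Set.range v).finrank K) *
          φ ((Set.range v).finrank K + 1)) := by
  classical
  rw [← (Fin.consEquiv (fun _ => V)).sum_comp, Fintype.sum_prod_type_right]
  refine Finset.sum_congr rfl fun v _ => ?_
  have hcard : (#{x | x ∈ Submodule.span K (Set.range v)} : ℝ) =
      (Fintype.card K : ℝ) ^ (Set.range v).finrank K := by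
    rw [← Fintype.card_subtype]
    exact_mod_cast Module.card_eq_pow_finrank (K := K) (V := Submodule.span K (Set.range v))
  have hcard' : (#{x | x ∉ Submodule.span K (Set.range v)} : ℝ) =
      (Fintype.card V : ℝ) - (Fintype.card K : ℝ) ^ (Set.range v).finrank K := by
    rw [← hcard, ← Finset.card_univ, ← Finset.card_filter_add_card_filter_not (s := univ)
      (fun x => x ∈ Submodule.span K (Set.range v))]
    push_cast
    ring
  have hval : ∀ x : V, φ ((Set.range (Fin.consEquiv (fun _ => V) (x, v))).finrank K) =
      if x ∈ Submodule.span K (Set.range v) then φ ((Set.range v).finrank K)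
      else φ ((Set.range v).finrank K + 1) := by
    intro x
    have : Set.range (Fin.consEquiv (fun _ => V) (x, v)) = insert x (Set.range v) :=
      Fin.range_cons x v
    rw [this]
    unfold Set.finrank
    split_ifs with hx
    · rw [Submodule.span_insert_eq_span hx]
    · rw [finrank_span_insert_of_notMem hx]
  simp only [hval]
  rw [Finset.sum_ite, Finset.sum_const, Finset.sum_const, nsmul_eq_mul, nsmul_eq_mul, hcard, hcard']

variable (K V) in
/-- The number of `k`-tuples of vectors with nullity `j`. -/
noncomputable def nullityCount (j k : ℕ) : ℝ :=
  ∑ v : Fin k → V, if (Set.range v).finrank K + j = k then 1 else 0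

variable (K V) in
/-- The number of `k`-tuples of vectors with nullity at least two. -/
noncomputable def nullityTwoCount (k : ℕ) : ℝ :=
  ∑ v : Fin k → V, if (Set.range v).finrank K + 2 ≤ k then 1 else 0

lemma finrank_range_le (k : ℕ) (v : Fin k → V) : (Set.range v).finrank K ≤ k := by
  simpa using finrank_range_le_card (R := K) v

lemma nullityCount_zero (k : ℕ) : nullityCount K V 0 k =
    ∏ i ∈ range k, ((Fintype.card V : ℝ) - (Fintype.card K : ℝ) ^ i) := by
  induction k with
  | zero => simp [nullityCount, Set.finrank]
  | succ k ih =>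
    rw [Finset.prod_range_succ, ← ih]
    unfold nullityCount
    rw [sum_finrank_range_succ (fun ρ => if ρ + 0 = k + 1 then 1 else 0), Finset.sum_mul]
    refine Finset.sum_congr rfl fun v _ => ?_
    have := finrank_range_le (K := K) k v
    rw [if_neg (by omega)]
    by_cases h : (Set.range v).finrank K = k
    · simp [h]
    · simp [h]

lemma nullityCount_one_zero : nullityCount K V 1 0 = 0 := by
  simp [nullityCount]

lemma nullityCount_one_succ (k : ℕ) : nullityCount K V 1 (k + 1) =
    nullityCount K V 0 k * (Fintype.card K : ℝ) ^ k +
      nullityCount K V 1 k * ((Fintype.card V : ℝ) - (Fintype.card K : ℝ) ^ (k - 1)) := by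
  unfold nullityCount
  rw [sum_finrank_range_succ (fun ρ => if ρ + 1 = k + 1 then 1 else 0), Finset.sum_mul,
    Finset.sum_mul, ← Finset.sum_add_distrib]
  refine Finset.sum_congr rfl fun v _ => ?_
  by_cases h : (Set.range v).finrank K = k
  · simp [h]
  · by_cases h1 : (Set.range v).finrank K + 1 = k
    · have h2 : (Set.range v).finrank K = k - 1 := by omega
      have h3 : k - 1 ≠ k := by omega
      have h4 : k - 1 + 1 = k := by omega
      simp [h2, h3, h4]
    · simp [h, h1]

lemma nullityCount_one (k : ℕ) : nullityCount K V 1 (k + 1) =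
    (∑ j ∈ range (k + 1), (Fintype.card K : ℝ) ^ j) *
      ∏ i ∈ range k, ((Fintype.card V : ℝ) - (Fintype.card K : ℝ) ^ i) := by
  induction k with
  | zero => simp [nullityCount_one_succ, nullityCount_one_zero, nullityCount_zero]
  | succ k ih =>
    rw [nullityCount_one_succ, ih, nullityCount_zero, Finset.sum_range_succ _ (k + 1),
      Finset.prod_range_succ, Nat.add_sub_cancel]
    ring

lemma nullityTwoCount_succ (k : ℕ) : nullityTwoCount K V (k + 1) =
    nullityTwoCount K V k * Fintype.card V +
      nullityCount K V 1 k * (Fintype.card K : ℝ) ^ (k - 1) := by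
  unfold nullityTwoCount nullityCount
  rw [sum_finrank_range_succ (fun ρ => if ρ + 2 ≤ k + 1 then 1 else 0), Finset.sum_mul,
    Finset.sum_mul, ← Finset.sum_add_distrib]
  refine Finset.sum_congr rfl fun v _ => ?_
  have := finrank_range_le (K := K) k v
  by_cases h : (Set.range v).finrank K + 1 = k
  · have h2 : (Set.range v).finrank K = k - 1 := by omega
    rw [if_pos (by omega), if_neg (by omega), if_neg (by omega), if_pos h, h2]
    ring
  · by_cases h1 : (Set.range v).finrank K + 2 ≤ k
    · rw [if_pos (by omega), if_pos (by omega), if_pos (by omega), if_neg (by omega)]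
      ring
    · rw [if_neg (by omega), if_neg (by omega), if_neg (by omega), if_neg (by omega)]
      ring

end Counting

section CountingTernary

variable {V : Type*} [AddCommGroup V] [Module (ZMod 3) V] [Fintype V]

lemma nullityCount_le (j k : ℕ) : nullityCount (ZMod 3) V j k ≤ (Fintype.card V : ℝ) ^ k := by
  unfold nullityCount
  calc _ ≤ ∑ v : Fin k → V, (1 : ℝ) := Finset.sum_le_sum fun v _ => by split_ifs <;> norm_num
    _ = _ := by simp

lemma nullityCount_one_le (k : ℕ) :
    2 * Fintype.card V * nullityCount (ZMod 3) V 1 k ≤ 3 ^ k * (Fintype.card V : ℝ) ^ k := by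
  induction k with
  | zero => simp [nullityCount_one_zero]
  | succ k ih =>
    rw [nullityCount_one_succ, ZMod.card]
    push_cast
    set Q : ℝ := (Fintype.card V : ℝ)
    have hQ : 0 ≤ Q := by positivity
    have h0 : nullityCount (ZMod 3) V 0 k ≤ Q ^ k := nullityCount_le 0 k
    have h1 : 0 ≤ nullityCount (ZMod 3) V 1 k :=
      Finset.sum_nonneg fun v _ => by split_ifs <;> norm_num
    calc 2 * Q * (nullityCount (ZMod 3) V 0 k * 3 ^ k +
          nullityCount (ZMod 3) V 1 k * (Q - 3 ^ (k - 1)))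
        ≤ 2 * Q * (Q ^ k * 3 ^ k + nullityCount (ZMod 3) V 1 k * Q) := by
          gcongr
          linarith [pow_pos (show (0 : ℝ) < 3 by norm_num) (k - 1)]
      _ = 2 * Q * (Q ^ k * 3 ^ k) + (2 * Q * nullityCount (ZMod 3) V 1 k) * Q := by ring
      _ ≤ 2 * Q * (Q ^ k * 3 ^ k) + (3 ^ k * Q ^ k) * Q := by gcongr
      _ = _ := by ring

lemma nullityTwoCount_le (k : ℕ) :
    48 * (Fintype.card V : ℝ) ^ 2 * nullityTwoCount (ZMod 3) V k ≤
      9 ^ k * (Fintype.card V : ℝ) ^ k := by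
  induction k with
  | zero => simp [nullityTwoCount]
  | succ k ih =>
    rw [nullityTwoCount_succ, ZMod.card]
    have h1 := nullityCount_one_le (V := V) k
    push_cast
    set Q : ℝ := (Fintype.card V : ℝ)
    have hQ : 0 ≤ Q := by positivity
    rcases k with _ | k
    · have : nullityTwoCount (ZMod 3) V 0 = 0 := by simp [nullityTwoCount]
      rw [nullityCount_one_zero, this]
      simp
      positivity
    · rw [Nat.add_sub_cancel]
      calc 48 * Q ^ 2 * (nullityTwoCount (ZMod 3) V (k + 1) * Q +
            nullityCount (ZMod 3) V 1 (k + 1) * 3 ^ k)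
          = (48 * Q ^ 2 * nullityTwoCount (ZMod 3) V (k + 1)) * Q +
            (2 * Q * nullityCount (ZMod 3) V 1 (k + 1)) * (24 * Q * 3 ^ k) := by ring
        _ ≤ (9 ^ (k + 1) * Q ^ (k + 1)) * Q +
            (3 ^ (k + 1) * Q ^ (k + 1)) * (24 * Q * 3 ^ k) := by gcongr
        _ = 9 ^ (k + 1) * Q ^ (k + 2) + 72 * (3 ^ k * 3 ^ k) * Q ^ (k + 2) := by ring
        _ = 9 ^ (k + 1 + 1) * Q ^ (k + 1 + 1) := by
          rw [← mul_pow]; norm_num; ring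

/-- At most a fraction `1 / 3888` of the tuples of at most `r - 2` vectors in an
`r`-dimensional space have nullity at least two. -/
lemma nullityTwoCount_le_of_add_two_le {k r : ℕ} (hkr : k + 2 ≤ r)
    (hV : Fintype.card V = 3 ^ r) :
    nullityTwoCount (ZMod 3) V k ≤ 1 / 3888 * (Fintype.card V : ℝ) ^ k := by
  have h := nullityTwoCount_le (V := V) k
  have hQ : (0 : ℝ) < Fintype.card V := by rw [hV]; positivity
  have h9 : (81 : ℝ) * 9 ^ k ≤ (Fintype.card V : ℝ) ^ 2 := by
    rw [hV]
    push_cast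
    rw [← pow_mul, mul_comm r 2, pow_mul]
    calc (81 : ℝ) * 9 ^ k = 9 ^ (k + 2) := by ring
      _ ≤ 9 ^ r := pow_le_pow_right₀ (by norm_num) hkr
      _ = _ := by norm_num
  have hp : (0 : ℝ) < (Fintype.card V : ℝ) ^ k := by positivity
  have h2 : (0 : ℝ) < (Fintype.card V : ℝ) ^ 2 := by positivity
  refine le_of_mul_le_mul_left ?_ (show (0 : ℝ) < 48 * (Fintype.card V : ℝ) ^ 2 by positivity)
  calc _ ≤ _ := h
    _ ≤ (Fintype.card V : ℝ) ^ 2 / 81 * (Fintype.card V : ℝ) ^ k := by gcongr; linarith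
    _ = _ := by ring

lemma prod_one_sub_inv_three_pow_le (m : ℕ) :
    (1 - (3 : ℝ)⁻¹ ^ (m + 1)) * ∏ j ∈ range m, (1 - (3 : ℝ)⁻¹ ^ (j + 2)) ≤ 0.846 := by
  have hf : ∀ j : ℕ, 0 ≤ 1 - (3 : ℝ)⁻¹ ^ j ∧ 1 - (3 : ℝ)⁻¹ ^ j ≤ 1 := fun j =>
    ⟨by linarith [pow_le_one₀ (n := j) (show (0 : ℝ) ≤ 3⁻¹ by norm_num) (by norm_num)],
      by linarith [pow_pos (show (0 : ℝ) < 3⁻¹ by norm_num) j]⟩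
  rcases Nat.lt_or_ge m 3 with hm | hm
  · interval_cases m <;> norm_num [Finset.prod_range_succ]
  · obtain ⟨l, rfl⟩ := Nat.exists_eq_add_of_le hm
    have hl : ∏ j ∈ range (3 + l), (1 - (3 : ℝ)⁻¹ ^ (j + 2)) ≤ 0.846 := by
      rw [Finset.prod_range_add]
      have h1 : ∏ x ∈ range l, (1 - (3 : ℝ)⁻¹ ^ (3 + x + 2)) ≤ 1 :=
        Finset.prod_le_one (fun i _ => (hf _).1) (fun i _ => (hf _).2)
      calc _ ≤ (∏ j ∈ range 3, (1 - (3 : ℝ)⁻¹ ^ (j + 2))) * 1 := by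
            refine mul_le_mul_of_nonneg_left h1 ?_
            exact Finset.prod_nonneg fun i _ => (hf _).1
        _ ≤ _ := by norm_num [Finset.prod_range_succ]
    exact (mul_le_of_le_one_left (Finset.prod_nonneg fun i _ => (hf _).1) (hf _).2).trans hl

/-- At most a fraction `0.423` of the `r`-tuples of vectors in an `r`-dimensional space have rank
exactly `r - 1`. -/
lemma nullityCount_one_self_le {r : ℕ} (hV : Fintype.card V = 3 ^ r) :
    nullityCount (ZMod 3) V 1 r ≤ 0.423 * (Fintype.card V : ℝ) ^ r := by
  rcases r with _ | m
  · rw [nullityCount_one_zero]; positivity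
  have hsum : ∑ j ∈ range (m + 1), (3 : ℝ) ^ j =
      3 ^ (m + 1) * (1 / 2 * (1 - (3 : ℝ)⁻¹ ^ (m + 1))) := by
    rw [geom_sum_eq (by norm_num), inv_pow]
    field_simp
    norm_num
  have hprod : ∏ i ∈ range m, ((3 : ℝ) ^ (m + 1) - 3 ^ i) =
      (3 ^ (m + 1)) ^ m * ∏ j ∈ range m, (1 - (3 : ℝ)⁻¹ ^ (j + 2)) := by
    rw [← Finset.prod_range_reflect, ← Finset.card_range m, ← Finset.prod_const, Finset.card_range,
      ← Finset.prod_mul_distrib]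
    refine Finset.prod_congr rfl fun j hj => ?_
    have hj : j < m := Finset.mem_range.1 hj
    rw [mul_sub, mul_one, inv_pow, ← div_eq_mul_inv, eq_comm,
      show m + 1 = (m - 1 - j) + (j + 2) by omega, pow_add _ _ (j + 2),
      mul_div_cancel_right₀ _ (by positivity)]
  rw [nullityCount_one, ZMod.card, hV]
  push_cast
  rw [hsum, hprod]
  calc _ = (1 / 2 * ((1 - (3 : ℝ)⁻¹ ^ (m + 1)) * ∏ j ∈ range m, (1 - (3 : ℝ)⁻¹ ^ (j + 2)))) *
        (3 ^ (m + 1)) ^ (m + 1) := by ring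
    _ ≤ (1 / 2 * 0.846) * (3 ^ (m + 1)) ^ (m + 1) := by
        gcongr
        exact prod_one_sub_inv_three_pow_le m
    _ = _ := by norm_num

end CountingTernary

section Layers

lemma sum_familyRank {K ι V : Type*} [Field K] [AddCommGroup V] [Module K V] [Fintype V]
    [Fintype ι] [DecidableEq ι] (φ : ℕ → ℝ) (S : Finset ι) :
    ∑ f : ι → V, φ (familyRank K f S) =
      (Fintype.card V : ℝ) ^ (Fintype.card ι - #S) *
        ∑ v : Fin #S → V, φ ((Set.range v).finrank K) := by
  classical
  rw [← (Equiv.piEquivPiSubtypeProd (· ∈ S) (fun _ => V)).symm.sum_comp, Fintype.sum_prod_type_right]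
  have h : ∀ w : {i // i ∉ S} → V, ∑ u : {i // i ∈ S} → V, φ (familyRank K
      ((Equiv.piEquivPiSubtypeProd (· ∈ S) (fun _ => V)).symm (u, w)) S) =
      ∑ v : Fin #S → V, φ ((Set.range v).finrank K) := by
    intro w
    rw [← (Equiv.arrowCongr S.equivFin (Equiv.refl V)).sum_comp]
    refine Finset.sum_congr rfl fun u _ => ?_
    congr 1
    unfold familyRank Set.finrank
    suffices h : ((Equiv.piEquivPiSubtypeProd (· ∈ S) (fun _ => V)).symm (u, w)) '' (S : Set ι) =
        Set.range (Equiv.arrowCongr S.equivFin (Equiv.refl V) u) by rw [h]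
    ext y
    constructor
    · rintro ⟨i, hi, rfl⟩
      have hi : i ∈ S := hi
      exact ⟨S.equivFin ⟨i, hi⟩, by simp [Equiv.arrowCongr, hi]⟩
    · rintro ⟨j, rfl⟩
      exact ⟨S.equivFin.symm j, (S.equivFin.symm j).2, by simp [Equiv.arrowCongr]⟩
  simp only [h]
  rw [Finset.sum_const, nsmul_eq_mul]
  congr 1
  rw [Finset.card_univ, Fintype.card_fun, Fintype.card_subtype_compl, Fintype.card_coe]
  push_cast
  rfl

/-- Row rank equals column rank, so tuples spanning a space of codimension at least two are
counted by tuples of nullity at least two. -/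
lemma sum_corank_two_eq (k r : ℕ) :
    (∑ v : Fin k → Fin r → ZMod 3,
      if (Set.range v).finrank (ZMod 3) + 2 ≤ r then (1 : ℝ) else 0) =
      nullityTwoCount (ZMod 3) (Fin k → ZMod 3) r := by
  unfold nullityTwoCount
  rw [← (Equiv.piComm (fun (_ : Fin r) (_ : Fin k) => ZMod 3)).sum_comp]
  refine Finset.sum_congr rfl fun v _ => ?_
  have h : (Set.range (Equiv.piComm (fun (_ : Fin r) (_ : Fin k) => ZMod 3) v)).finrank (ZMod 3) =
      (Set.range v).finrank (ZMod 3) := by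
    have h1 := Matrix.rank_transpose (Matrix.of v)
    rw [Matrix.rank_eq_finrank_span_row, Matrix.rank_eq_finrank_span_row] at h1
    exact h1
  rw [h]

variable {n : ℕ}

/-- The sets chosen on account of the layer of `r`-sets: the `r`-sets of corank one, together with
a sparse family of sets of nearby size whose rank is too small. -/
noncomputable def hitLayer (r : ℕ) (f : Fin n → Fin r → ZMod 3) : Finset (Finset (Fin n)) :=
  {S | (#S = r ∧ familyRank (ZMod 3) f S + 1 = r) ∨
    ((#S + 2 ≤ r ∧ r ≤ #S + 4) ∧ familyRank (ZMod 3) f S + 2 ≤ #S) ∨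
    ((r + 2 ≤ #S ∧ #S ≤ r + 4) ∧ familyRank (ZMod 3) f S + 2 ≤ r)}

/-- An upper bound for the probability that a given `s`-set lies in a random `hitLayer r`. -/
noncomputable def hitWeight (r s : ℕ) : ℝ :=
  (if s = r then 0.423 else 0) + (if s + 2 ≤ r ∧ r ≤ s + 4 then 1 / 3888 else 0) +
    (if r + 2 ≤ s ∧ s ≤ r + 4 then 1 / 3888 else 0)

lemma sum_hitWeight_le (N s : ℕ) : ∑ r ∈ range N, hitWeight r s ≤ 0.425 := by
  unfold hitWeight
  rw [Finset.sum_add_distrib, Finset.sum_add_distrib, ← Finset.sum_filter, ← Finset.sum_filter,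
    ← Finset.sum_filter]
  simp only [Finset.sum_const, nsmul_eq_mul]
  have h1 : #{r ∈ range N | s = r} ≤ 1 :=
    (Finset.card_le_card (t := {s}) fun r hr => by
      simp only [Finset.mem_filter, Finset.mem_singleton] at hr ⊢; omega).trans (by simp)
  have h2 : #{r ∈ range N | s + 2 ≤ r ∧ r ≤ s + 4} ≤ 3 :=
    (Finset.card_le_card (t := Finset.Icc (s + 2) (s + 4)) fun r hr => by
      simp only [Finset.mem_filter, Finset.mem_Icc] at hr ⊢; omega).trans
      (by rw [Nat.card_Icc]; omega)
  have h3 : #{r ∈ range N | r + 2 ≤ s ∧ s ≤ r + 4} ≤ 3 :=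
    (Finset.card_le_card (t := Finset.Icc (s - 4) (s - 2)) fun r hr => by
      simp only [Finset.mem_filter, Finset.mem_Icc] at hr ⊢; omega).trans
      (by rw [Nat.card_Icc]; omega)
  replace h1 := (Nat.cast_le (α := ℝ)).2 h1
  replace h2 := (Nat.cast_le (α := ℝ)).2 h2
  replace h3 := (Nat.cast_le (α := ℝ)).2 h3
  rw [Nat.cast_one] at h1
  rw [Nat.cast_ofNat] at h2 h3
  linarith

lemma sum_mem_hitLayer_le (r : ℕ) (S : Finset (Fin n)) :
    (∑ f : Fin n → Fin r → ZMod 3, if S ∈ hitLayer r f then (1 : ℝ) else 0) ≤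
      hitWeight r #S * Fintype.card (Fin n → Fin r → ZMod 3) := by
  have hV : Fintype.card (Fin r → ZMod 3) = 3 ^ r := by simp
  have hS : #S ≤ n := by simpa using Finset.card_le_univ S
  have key : ∀ (p : ℕ → Prop) [DecidablePred p] (c : ℝ),
      (∑ v : Fin #S → Fin r → ZMod 3, if p ((Set.range v).finrank (ZMod 3)) then (1 : ℝ) else 0) ≤
        c * (Fintype.card (Fin r → ZMod 3) : ℝ) ^ #S →
      (∑ f : Fin n → Fin r → ZMod 3, if p (familyRank (ZMod 3) f S) then (1 : ℝ) else 0) ≤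
        c * Fintype.card (Fin n → Fin r → ZMod 3) := by
    intro p _ c h
    rw [sum_familyRank (fun ρ => if p ρ then (1 : ℝ) else 0), Fintype.card_fin]
    calc _ ≤ (Fintype.card (Fin r → ZMod 3) : ℝ) ^ (n - #S) *
          (c * (Fintype.card (Fin r → ZMod 3) : ℝ) ^ #S) := by gcongr
      _ = c * (Fintype.card (Fin r → ZMod 3) : ℝ) ^ (n - #S + #S) := by rw [pow_add]; ring
      _ = _ := by rw [Nat.sub_add_cancel hS, Fintype.card_fun (α := Fin n), Fintype.card_fin,
          Nat.cast_pow]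
  unfold hitLayer hitWeight
  simp only [Finset.mem_filter_univ]
  by_cases h1 : #S = r
  · have h2 : ¬(#S + 2 ≤ #S ∧ #S ≤ #S + 4) := by omega
    subst h1
    simp only [h2, true_and, false_and, or_false, if_true, if_false, add_zero]
    exact key (fun ρ => ρ + 1 = #S) _ (nullityCount_one_self_le hV)
  by_cases h2 : #S + 2 ≤ r ∧ r ≤ #S + 4
  · have h3 : ¬(r + 2 ≤ #S ∧ #S ≤ r + 4) := by omega
    simp only [h1, h2, h3, true_and, false_and, or_false, false_or, if_true, if_false, add_zero,
      zero_add]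
    exact key (fun ρ => ρ + 2 ≤ #S) _ (nullityTwoCount_le_of_add_two_le h2.1 hV)
  by_cases h3 : r + 2 ≤ #S ∧ #S ≤ r + 4
  · simp only [h1, h2, h3, true_and, false_and, false_or, if_true, if_false, zero_add]
    refine key (fun ρ => ρ + 2 ≤ r) _ ?_
    rw [sum_corank_two_eq]
    refine (nullityTwoCount_le_of_add_two_le h3.1 (by simp)).trans_eq ?_
    simp only [Fintype.card_fun, ZMod.card, Fintype.card_fin]
    push_cast
    rw [← pow_mul, ← pow_mul, mul_comm r]
  · simp only [h1, h2, h3, false_and, or_false, if_false, Finset.sum_const_zero]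
    simp

lemma exists_card_hitLayer_le (n r : ℕ) : ∃ f : Fin n → Fin r → ZMod 3,
    (#(hitLayer r f) : ℝ) ≤ ∑ S : Finset (Fin n), hitWeight r #S := by
  have h : ∑ f : Fin n → Fin r → ZMod 3, (#(hitLayer r f) : ℝ) ≤
      ∑ f : Fin n → Fin r → ZMod 3, ∑ S : Finset (Fin n), hitWeight r #S := by
    calc _ = ∑ f : Fin n → Fin r → ZMod 3, ∑ S : Finset (Fin n),
          (if S ∈ hitLayer r f then (1 : ℝ) else 0) := by simp
      _ = ∑ S : Finset (Fin n), ∑ f : Fin n → Fin r → ZMod 3,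
          (if S ∈ hitLayer r f then (1 : ℝ) else 0) := Finset.sum_comm
      _ ≤ ∑ S : Finset (Fin n), hitWeight r #S * Fintype.card (Fin n → Fin r → ZMod 3) :=
          Finset.sum_le_sum fun S _ => sum_mem_hitLayer_le r S
      _ = _ := by rw [← Finset.sum_mul, Finset.sum_const, nsmul_eq_mul, mul_comm, Finset.card_univ]
  obtain ⟨f, -, hf⟩ := Finset.exists_le_of_sum_le Finset.univ_nonempty h
  exact ⟨f, hf⟩

/-- The union of the families `hitLayer r` over a residue class of `r` modulo `3`. -/
lemma isHitting_biUnion_hitLayer (F : ∀ r, Fin n → Fin r → ZMod 3) {a : ℕ} (ha : a < 3) :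
    IsHitting n 6 ({r ∈ range (n + 1) | r % 3 = a}.biUnion fun r => hitLayer r (F r)) := by
  intro X Y hX hXY
  obtain ⟨t, ht2, ht4, hta⟩ : ∃ t, 2 ≤ t ∧ t ≤ 4 ∧ (#Y + t) % 3 = a := by
    by_contra! h
    have h2 := h 2 (by omega) (by omega)
    have h3 := h 3 (by omega) (by omega)
    have h4 := h 4 (by omega) (by omega)
    omega
  have hcard : ∀ A ⊆ X, #(Y ∪ A) = #Y + #A := fun A hA =>
    Finset.card_union_of_disjoint (Finset.disjoint_of_subset_left hA hXY).symm
  have hn : #Y + 6 ≤ n := by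
    rw [← hX, ← hcard X subset_rfl]
    simpa using Finset.card_le_univ (Y ∪ X)
  suffices h : ∃ A ⊆ X, Y ∪ A ∈ hitLayer (#Y + t) (F (#Y + t)) by
    obtain ⟨A, hA, hmem⟩ := h
    exact ⟨A, hA, Finset.mem_biUnion.2 ⟨#Y + t, by simp [hta]; omega, hmem⟩⟩
  simp only [hitLayer, Finset.mem_filter_univ]
  have hr : Module.finrank (ZMod 3) (Fin (#Y + t) → ZMod 3) = #Y + t := by simp
  rcases exists_corank_one_or_deficient (F (#Y + t)) hXY hX ht2 ht4 hr.symm with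
    ⟨A, hAX, hA, hrk⟩ | hrk | hrk
  · exact ⟨A, hAX, Or.inl ⟨by rw [hcard A hAX, hA], hrk.trans hr⟩⟩
  · exact ⟨∅, by simp, Or.inr (Or.inl (by rw [Finset.union_empty]; omega))⟩
  · refine ⟨X, subset_rfl, Or.inr (Or.inr ⟨?_, hrk.trans_eq hr⟩)⟩
    rw [hcard X subset_rfl]
    omega

end Layers

/-- There is a constant `c < 1/8` such that `g(n,6) ≤ c·2^n` for every positive integer `n`;
in particular `γ_6 < 1/7`. -/
theorem turan_density_Q6 :
    ∃ c : ℝ, c < 1 / 7 ∧ ∀ n : ℕ, 0 < n → (g n 6 : ℝ) ≤ c * 2 ^ n := by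
  refine ⟨0.425 / 3, by norm_num, fun n _ => ?_⟩
  choose F hF using exists_card_hitLayer_le n
  let G : ℕ → Finset (Finset (Fin n)) := fun a =>
    {r ∈ range (n + 1) | r % 3 = a}.biUnion fun r => hitLayer r (F r)
  have hG : ∑ a ∈ range 3, (#(G a) : ℝ) ≤ ∑ _a ∈ range 3, 0.425 / 3 * 2 ^ n := by
    calc ∑ a ∈ range 3, (#(G a) : ℝ)
        ≤ ∑ a ∈ range 3, ∑ r ∈ range (n + 1) with r % 3 = a, (#(hitLayer r (F r)) : ℝ) :=
          Finset.sum_le_sum fun a _ => by exact_mod_cast Finset.card_biUnion_le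
      _ = ∑ r ∈ range (n + 1), (#(hitLayer r (F r)) : ℝ) :=
          Finset.sum_fiberwise_of_maps_to
            (fun r _ => Finset.mem_range.2 (Nat.mod_lt r (by norm_num))) _
      _ ≤ ∑ r ∈ range (n + 1), ∑ S : Finset (Fin n), hitWeight r #S :=
          Finset.sum_le_sum fun r _ => hF r
      _ = ∑ S : Finset (Fin n), ∑ r ∈ range (n + 1), hitWeight r #S := Finset.sum_comm
      _ ≤ ∑ _S : Finset (Fin n), 0.425 := Finset.sum_le_sum fun S _ => sum_hitWeight_le _ _
      _ = _ := by simp; ring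
  obtain ⟨a, ha, hle⟩ := Finset.exists_le_of_sum_le (by simp) hG
  have hmin : g n 6 ≤ #(G a) :=
    Nat.sInf_le ⟨G a, isHitting_biUnion_hitLayer F (Finset.mem_range.1 ha), rfl⟩
  exact (Nat.cast_le.2 hmin).trans hle
end

section
/- For every positive integer n, g(n,6) ≤ (3/25)·2^n; that is, there is a Q_6-hitting set in Q_n of size at most 0.12·2^n. -/
instance fact_prime_five : Fact (Nat.Prime 5) := ⟨by norm_num⟩

/-- If the functionals indexed by `T` have trivial common kernel and `T` is no larger than the
dimension, then each of them takes the value `1` at a point where the others vanish. -/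
lemma exists_apply_eq_one_of_card_le_finrank {K D ι : Type*} [Field K] [AddCommGroup D]
    [Module K D] [FiniteDimensional K D] [DecidableEq ι] (l : ι → D →ₗ[K] K) (T : Finset ι)
    (hD : T.card ≤ Module.finrank K D) (hT : ∀ w, (∀ t ∈ T, l t w = 0) → w = 0)
    {t : ι} (ht : t ∈ T) : ∃ w, l t w = 1 ∧ ∀ s ∈ T, s ≠ t → l s w = 0 := by
  let e : D →ₗ[K] (T → K) := LinearMap.pi fun t => l t
  have he : Function.Injective e := by
    refine (injective_iff_map_eq_zero e).2 fun w hw => hT w fun t ht => ?_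
    exact congrFun hw ⟨t, ht⟩
  have hfin : Module.finrank K D = Module.finrank K (T → K) := by
    refine le_antisymm (LinearMap.finrank_le_finrank_of_injective he) ?_
    simpa using hD
  obtain ⟨w, hw⟩ := (LinearMap.injective_iff_surjective_of_finrank_eq_finrank hfin).1 he
    (Pi.single ⟨t, ht⟩ 1)
  refine ⟨w, ?_, fun s hs hst => ?_⟩
  · simpa [e] using congrFun hw ⟨t, ht⟩
  · simpa [e, hst] using congrFun hw ⟨s, hs⟩

/-- There is no two-dimensional MDS code of length seven over `ZMod 5`. -/
lemma no_mds_code_two {D : Type*} [AddCommGroup D] [Module (ZMod 5) D]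
    [FiniteDimensional (ZMod 5) D] (l : Fin 7 → D →ₗ[ZMod 5] ZMod 5)
    (hD : 2 ≤ Module.finrank (ZMod 5) D)
    (h : ∀ T : Finset (Fin 7), T.card = 2 → ∀ w, (∀ t ∈ T, l t w = 0) → w = 0) : False := by
  have h2 (i j : Fin 7) (hij : i ≠ j) (w : D) (hi : l i w = 0) (hj : l j w = 0) : w = 0 :=
    h {i, j} (Finset.card_pair hij) w (by simp [hi, hj])
  have hT := h {0, 1} rfl
  obtain ⟨f, hf0, hf⟩ := exists_apply_eq_one_of_card_le_finrank l {0, 1} hD hT (t := 0) (by simp)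
  obtain ⟨g, hg1, hg⟩ := exists_apply_eq_one_of_card_le_finrank l {0, 1} hD hT (t := 1) (by simp)
  have hf1 : l 1 f = 0 := hf 1 (by simp) (by decide)
  have hg0 : l 0 g = 0 := hg 0 (by simp) (by decide)
  have hf_ne (j : Fin 7) (hj : j ≠ 1) : l j f ≠ 0 := fun h0 => by
    simp [h2 _ _ hj f h0 hf1] at hf0
  have hg_ne (j : Fin 7) (hj : j ≠ 0) : l j g ≠ 0 := fun h0 => by
    simp [h2 _ _ hj g h0 hg0] at hg1
  let ρ (i : Fin 5) : ZMod 5 := l (i.natAdd 2) f / l (i.natAdd 2) g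
  have hne (i : Fin 5) : i.natAdd 2 ≠ (0 : Fin 7) ∧ i.natAdd 2 ≠ (1 : Fin 7) := by
    revert i; decide
  have hρ : Function.Injective ρ := by
    intro i j hij
    by_contra hne'
    have hw : f - ρ i • g = 0 := by
      refine h2 (i.natAdd 2) (j.natAdd 2) ((Fin.natAdd_injective 5 2).ne hne') _ ?_ ?_
      · simp [ρ, div_mul_cancel₀ _ (hg_ne _ (hne i).1)]
      · simp [hij, ρ, div_mul_cancel₀ _ (hg_ne _ (hne j).1)]
    have := congrArg (l 0) hw
    simp [hf0, hg0] at this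
  obtain ⟨i, hi⟩ := (Finite.injective_iff_surjective_of_equiv
    (ZMod.finEquiv 5).toEquiv).1 hρ 0
  exact div_ne_zero (hf_ne _ (hne i).2) (hg_ne _ (hne i).1) hi

lemma prod_eq_neg_one_of_injective (ρ : Fin 4 → ZMod 5) (hρ : Function.Injective ρ)
    (h0 : ∀ i, ρ i ≠ 0) : ∏ i, ρ i = -1 := by
  have himage : Finset.univ.image ρ = Finset.univ.erase 0 := by
    refine Finset.eq_of_subset_of_card_le (fun x hx => ?_) ?_
    · obtain ⟨i, -, rfl⟩ := Finset.mem_image.1 hx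
      simpa using h0 i
    · rw [Finset.card_image_of_injective _ hρ]
      decide
  calc ∏ i, ρ i = ∏ x ∈ Finset.univ.image ρ, x := by
        rw [Finset.prod_image hρ.injOn]
    _ = -1 := by rw [himage]; decide

/-- There is no three-dimensional MDS code of length seven over `ZMod 5`. -/
lemma no_mds_code_three {D : Type*} [AddCommGroup D] [Module (ZMod 5) D]
    [FiniteDimensional (ZMod 5) D] (l : Fin 7 → D →ₗ[ZMod 5] ZMod 5)
    (hD : 3 ≤ Module.finrank (ZMod 5) D)
    (h : ∀ T : Finset (Fin 7), T.card = 3 → ∀ w, (∀ t ∈ T, l t w = 0) → w = 0) : False := by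
  have h3 (i j k : Fin 7) (hij : i ≠ j) (hik : i ≠ k) (hjk : j ≠ k) (w : D)
      (hi : l i w = 0) (hj : l j w = 0) (hk : l k w = 0) : w = 0 :=
    h {i, j, k} (Finset.card_eq_three.2 ⟨i, j, k, hij, hik, hjk, rfl⟩) w (by simp [hi, hj, hk])
  have hunit (t : Fin 3) : ∃ w, ∀ s : Fin 3,
      l (s.castLE (by norm_num)) w = if s = t then 1 else 0 := by
    obtain ⟨w, hw1, hw0⟩ := exists_apply_eq_one_of_card_le_finrank l {0, 1, 2} hD (h _ rfl)
      (t := t.castLE (by norm_num)) (by revert t; decide)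
    refine ⟨w, fun s => ?_⟩
    split_ifs with hst
    · rw [hst, hw1]
    · exact hw0 _ (by clear hst; revert s; decide) (by simpa using hst)
  choose u hu using hunit
  have hne (i : Fin 4) (s : Fin 3) : s.castLE (by norm_num) ≠ (i.natAdd 3 : Fin 7) := by
    revert i s; decide
  have hu_ne (s : Fin 3) (i : Fin 4) : l (i.natAdd 3) (u s) ≠ 0 := by
    intro h0
    have hs : s + 1 ≠ s + 2 ∧ s + 1 ≠ s ∧ s + 2 ≠ s := by
      clear h0; revert s; decide
    have hus := hu s s
    have hw : u s = 0 := by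
      refine h3 ((s + 1).castLE (by norm_num)) ((s + 2).castLE (by norm_num)) (i.natAdd 3)
        (by simp) (hne _ _) (hne _ _) _ ?_ ?_ h0
      · rw [hu, if_neg hs.2.1]
      · rw [hu, if_neg hs.2.2]
    simp [hw] at hus
  have hprod (s t : Fin 3) (hst : s ≠ t) :
      ∏ i : Fin 4, (l (i.natAdd 3) (u s) / l (i.natAdd 3) (u t)) = -1 := by
    refine prod_eq_neg_one_of_injective _ (fun i j hij => ?_)
      fun i => div_ne_zero (hu_ne s i) (hu_ne t i)
    by_contra hne'
    obtain ⟨r, hrs, hrt⟩ : ∃ r : Fin 3, r ≠ s ∧ r ≠ t := by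
      clear hij; revert s t; decide
    have hw : u s - (l (i.natAdd 3) (u s) / l (i.natAdd 3) (u t)) • u t = 0 := by
      refine h3 (r.castLE (by norm_num)) (i.natAdd 3) (j.natAdd 3) (hne _ _) (hne _ _)
        ((Fin.natAdd_injective 4 3).ne hne') _ ?_ ?_ ?_
      · simp [hu, hrs, hrt]
      · simp [div_mul_cancel₀ _ (hu_ne t i)]
      · simp [hij, div_mul_cancel₀ _ (hu_ne t j)]
    have := congrArg (l (s.castLE (by norm_num))) hw
    simp [hu, hst] at this
  have hmul : (-1 : ZMod 5) * -1 = -1 := by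
    have hmul' := Finset.prod_mul_distrib (s := Finset.univ)
      (f := fun i : Fin 4 => l (i.natAdd 3) (u 0) / l (i.natAdd 3) (u 1))
      (g := fun i : Fin 4 => l (i.natAdd 3) (u 1) / l (i.natAdd 3) (u 2))
    simp only [div_mul_div_cancel₀ (hu_ne 1 _)] at hmul'
    rw [hprod 0 2 (by decide), hprod 0 1 (by decide), hprod 1 2 (by decide)] at hmul'
    exact hmul'.symm
  revert hmul; decide

/-- There is no MDS code of length seven and dimension two or three over `ZMod 5`. -/
lemma no_mds_code {D ι : Type*} [AddCommGroup D] [Module (ZMod 5) D]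
    [FiniteDimensional (ZMod 5) D] [Fintype ι] (hι : Fintype.card ι = 7)
    (l : ι → D →ₗ[ZMod 5] ZMod 5) {d : ℕ} (hd : d = 2 ∨ d = 3)
    (hD : d ≤ Module.finrank (ZMod 5) D)
    (h : ∀ T : Finset ι, T.card = d → ∀ w, (∀ t ∈ T, l t w = 0) → w = 0) : False := by
  let e := (Fintype.equivFinOfCardEq hι).symm
  have h' (T : Finset (Fin 7)) (hT : T.card = d) (w : D) (hw : ∀ t ∈ T, l (e t) w = 0) : w = 0 :=
    h (T.map e.toEmbedding) (by simpa using hT) w fun t ht => by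
      obtain ⟨i, hi, rfl⟩ := Finset.mem_map.1 ht
      exact hw i hi
  obtain rfl | rfl := hd
  · exact no_mds_code_two (fun t => l (e t)) hD h'
  · exact no_mds_code_three (fun t => l (e t)) hD h'

/-- The square submatrix of `M` with rows `S` and the first `#S` columns. -/
def leadingSubmatrix {n : ℕ} {K : Type*} (M : Matrix (Fin n) (Fin n) K) (S : Finset (Fin n)) :
    Matrix (Fin S.card) (Fin S.card) K :=
  M.submatrix (S.orderEmbOfFin rfl) (Fin.castLE (card_finset_fin_le S))

section Independence

variable {n r : ℕ} {K : Type*} [Field K] {M : Matrix (Fin n) (Fin n) K} {S : Finset (Fin n)}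

lemma eq_zero_of_forall_sum_mul_row_eq_zero (hS : (leadingSubmatrix M S).det ≠ 0)
    (hr : S.card = r) (hrn : r ≤ n) (u : Fin r → K)
    (hu : ∀ i ∈ S, ∑ j, M i (j.castLE hrn) * u j = 0) : u = 0 := by
  subst hr
  by_contra hne
  refine hS (Matrix.exists_mulVec_eq_zero_iff.1 ⟨u, hne, ?_⟩)
  ext p
  exact hu _ (S.orderEmbOfFin_mem rfl p)

lemma eq_zero_of_forall_sum_mul_col_eq_zero (hS : (leadingSubmatrix M S).det ≠ 0)
    (hr : S.card = r) (hrn : r ≤ n) (c : Fin n → K)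
    (hc : ∀ j : Fin r, ∑ i ∈ S, c i * M i (j.castLE hrn) = 0) : ∀ i ∈ S, c i = 0 := by
  subst hr
  have hzero : (fun p => c (S.orderEmbOfFin rfl p)) = 0 := by
    by_contra hne
    refine hS (Matrix.exists_vecMul_eq_zero_iff.1 ⟨_, hne, ?_⟩)
    ext j
    have hsum := Finset.sum_map Finset.univ (S.orderEmbOfFin rfl).toEmbedding
      fun i => c i * M i (j.castLE hrn)
    rw [S.map_orderEmbOfFin_univ rfl, hc j] at hsum
    exact hsum.symm
  intro i hi
  obtain ⟨p, rfl⟩ : i ∈ Set.range (S.orderEmbOfFin rfl) := by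
    simpa using hi
  exact congrFun hzero p

end Independence

lemma finrank_sub_finrank_le_finrank_ker {K V W : Type*} [Field K] [AddCommGroup V]
    [AddCommGroup W] [Module K V] [Module K W] [FiniteDimensional K V] [FiniteDimensional K W]
    (f : V →ₗ[K] W) :
    Module.finrank K V - Module.finrank K W ≤ Module.finrank K (LinearMap.ker f) := by
  have := f.finrank_range_add_finrank_ker
  have := Submodule.finrank_le (LinearMap.range f)
  omega

section Hitting

variable {n k : ℕ} {M : Matrix (Fin n) (Fin n) (ZMod 5)} {X Y : Finset (Fin n)}

/-- Otherwise the functionals vanishing on the rows `Y` would form an MDS code of length seven and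
dimension `k + 1`. -/
lemma exists_det_eq_zero_of_small (hX : X.card = 6) (hXY : Disjoint X Y) (hk : k = 1 ∨ k = 2) :
    ∃ A ⊆ X, (A.card = k ∨ A.card = k + 1) ∧ (leadingSubmatrix M (Y ∪ A)).det = 0 := by
  by_contra! H
  have hn : Y.card + k + 1 ≤ n := by
    have := card_finset_fin_le (X ∪ Y)
    rw [Finset.card_union_of_disjoint hXY] at this
    omega
  let φ : (Fin (Y.card + k + 1) → ZMod 5) →ₗ[ZMod 5] (Y → ZMod 5) :=
    (M.submatrix (fun y : Y => (y : Fin n)) (Fin.castLE hn)).mulVecLin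
  let l (t : Option X) : LinearMap.ker φ →ₗ[ZMod 5] ZMod 5 :=
    (t.elim (LinearMap.proj (Fin.last (Y.card + k)))
      fun x => LinearMap.proj x.1 ∘ₗ (M.submatrix id (Fin.castLE hn)).mulVecLin) ∘ₗ
      (LinearMap.ker φ).subtype
  refine no_mds_code (by simp [hX]) l (d := k + 1) (by omega) ?_ ?_
  · have := finrank_sub_finrank_le_finrank_ker φ
    simp only [Module.finrank_fintype_fun_eq_card, Fintype.card_fin, Fintype.card_coe] at this
    omega
  rintro T hT ⟨u, hu⟩ hw
  let A := T.eraseNone.map (Function.Embedding.subtype (· ∈ X))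
  have hAX : A ⊆ X := fun i hi => by
    obtain ⟨x, -, rfl⟩ := Finset.mem_map.1 hi
    exact x.2
  have hcard : (Y ∪ A).card = Y.card + A.card :=
    Finset.card_union_of_disjoint (hXY.symm.mono_right hAX)
  have hrow : ∀ i ∈ Y ∪ A, ∑ j, M i (j.castLE hn) * u j = 0 := by
    intro i hi
    obtain hi | hi := Finset.mem_union.1 hi
    · exact congrFun hu ⟨i, hi⟩
    · obtain ⟨x, hx, rfl⟩ := Finset.mem_map.1 hi
      exact hw (some x) (Finset.mem_eraseNone.1 hx)
  rw [Submodule.mk_eq_zero]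
  by_cases hnone : none ∈ T
  · have hAk : A.card = k := by
      simp [A, Finset.card_eraseNone_of_mem hnone, hT]
    have hlast : u (Fin.last _) = 0 := hw none hnone
    have hinit := eq_zero_of_forall_sum_mul_row_eq_zero (H A hAX (.inl hAk))
      (hcard.trans (by rw [hAk])) (by omega) (fun j => u j.castSucc) fun i hi => by
        simpa [Fin.sum_univ_castSucc, hlast] using hrow i hi
    ext j
    exact Fin.lastCases hlast (congrFun hinit) j
  · have hAk : A.card = k + 1 := by
      simp [A, Finset.card_eraseNone_of_not_mem hnone, hT]
    exact eq_zero_of_forall_sum_mul_row_eq_zero (H A hAX (.inr hAk))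
      (hcard.trans (by rw [hAk]; rfl)) hn u hrow

/-- Otherwise the linear relations between the rows `X ∪ Y` and a unit vector would form an MDS
code of length seven and dimension `6 - k`. -/
lemma exists_det_eq_zero_of_large (hX : X.card = 6) (hXY : Disjoint X Y) (hk : k = 3 ∨ k = 4) :
    ∃ A ⊆ X, (A.card = k ∨ A.card = k + 1) ∧ (leadingSubmatrix M (Y ∪ A)).det = 0 := by
  by_contra! H
  have hcardXY : (X ∪ Y).card = Y.card + 6 := by
    rw [Finset.card_union_of_disjoint hXY, hX, add_comm]
  have hcompl := Finset.card_add_card_compl (X ∪ Y)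
  rw [Fintype.card_fin] at hcompl
  have hn : Y.card + k + 1 ≤ n := by omega
  let φ : ((Fin n → ZMod 5) × ZMod 5) →ₗ[ZMod 5]
      (Fin (Y.card + k + 1) → ZMod 5) × (((X ∪ Y)ᶜ : Finset (Fin n)) → ZMod 5) :=
    ((M.submatrix id (Fin.castLE hn)).vecMulLinear.coprod
      (LinearMap.single _ (fun _ => ZMod 5) (Fin.last (Y.card + k)))).prod
      ((LinearMap.funLeft _ _ Subtype.val) ∘ₗ LinearMap.fst _ _ _)
  let l (t : Option X) : LinearMap.ker φ →ₗ[ZMod 5] ZMod 5 :=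
    (t.elim (LinearMap.snd _ _ _) fun x => LinearMap.proj x.1 ∘ₗ LinearMap.fst _ _ _) ∘ₗ
      (LinearMap.ker φ).subtype
  refine no_mds_code (by simp [hX]) l (d := 6 - k) (by omega) ?_ ?_
  · have := finrank_sub_finrank_le_finrank_ker φ
    simp only [Module.finrank_prod, Module.finrank_fintype_fun_eq_card, Fintype.card_fin,
      Fintype.card_coe, Module.finrank_self] at this
    omega
  rintro T hT ⟨⟨c, d⟩, hcd⟩ hw
  obtain ⟨hrel, hsupp⟩ := Prod.mk.inj hcd
  let A := Tᶜ.eraseNone.map (Function.Embedding.subtype (· ∈ X))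
  have hAX : A ⊆ X := fun i hi => by
    obtain ⟨x, -, rfl⟩ := Finset.mem_map.1 hi
    exact x.2
  have hcard : (Y ∪ A).card = Y.card + A.card :=
    Finset.card_union_of_disjoint (hXY.symm.mono_right hAX)
  have hTc : Tᶜ.card = k + 1 := by
    rw [Finset.card_compl, hT]
    simp [hX]
    omega
  have hc : ∀ i ∉ Y ∪ A, c i = 0 := by
    intro i hi
    rw [Finset.mem_union, not_or] at hi
    by_cases hiX : i ∈ X
    · refine hw (some ⟨i, hiX⟩) ?_
      by_contra hiT
      exact hi.2 (Finset.mem_map.2 ⟨⟨i, hiX⟩, by simpa using hiT, rfl⟩)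
    · exact congrFun hsupp ⟨i, by simp [hiX, hi.1]⟩
  have hcol (j : Fin (Y.card + k + 1)) : ∑ i ∈ Y ∪ A, c i * M i (j.castLE hn) +
      (Pi.single (Fin.last (Y.card + k)) d : Fin (Y.card + k + 1) → ZMod 5) j = 0 := by
    rw [Finset.sum_subset (Finset.subset_univ _) fun i _ hi => by rw [hc i hi, zero_mul]]
    exact congrFun hrel j
  have hfin : (∀ i ∈ Y ∪ A, c i = 0) → d = 0 → c = 0 ∧ d = 0 := fun h0 hd =>
    ⟨funext fun i => if hi : i ∈ Y ∪ A then h0 i hi else hc i hi, hd⟩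
  rw [Submodule.mk_eq_zero, Prod.mk_eq_zero]
  by_cases hnone : none ∈ T
  · have hAk : A.card = k + 1 := by
      simp [A, Finset.card_eraseNone_of_not_mem (show none ∉ Tᶜ by simpa using hnone), hTc]
    have hd : d = 0 := hw none hnone
    refine hfin (eq_zero_of_forall_sum_mul_col_eq_zero (H A hAX (.inr hAk))
      (hcard.trans (by rw [hAk]; rfl)) hn c fun j => ?_) hd
    simpa [hd] using hcol j
  · have hAk : A.card = k := by
      simp [A, Finset.card_eraseNone_of_mem (show none ∈ Tᶜ by simpa using hnone), hTc]
    have h0 := eq_zero_of_forall_sum_mul_col_eq_zero (H A hAX (.inl hAk))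
      (hcard.trans (by rw [hAk])) (by omega) c fun j => by
        simpa using hcol j.castSucc
    refine hfin h0 ?_
    have hlast := hcol (Fin.last _)
    rw [Finset.sum_eq_zero fun i hi => by rw [h0 i hi, zero_mul]] at hlast
    simpa using hlast

end Hitting

/-- The fibres of a surjective homomorphism all have the same size. -/
lemma card_filter_comp_mul_card {V W : Type*} [AddGroup V] [AddGroup W] [Fintype V] [Fintype W]
    [DecidableEq W] (f : V →+ W) (hf : Function.Surjective f) (P : W → Prop) [DecidablePred P] :
    (Finset.univ.filter fun v => P (f v)).card * Fintype.card W =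
      (Finset.univ.filter P).card * Fintype.card V := by
  have hfiber (w : W) : (Finset.univ.filter fun v => f v = w).card =
      (Finset.univ.filter fun v => f v = 0).card :=
    AddMonoidHom.card_fiber_eq_of_mem_range f (hf w) (hf 0)
  have hV : Fintype.card V = Fintype.card W * (Finset.univ.filter fun v => f v = 0).card := by
    rw [← Finset.card_univ, Finset.card_eq_sum_card_fiberwise (f := f) (t := Finset.univ)
      (by simp), Finset.sum_congr rfl fun w _ => hfiber w, Finset.sum_const, smul_eq_mul,
      Finset.card_univ]
  have hP : (Finset.univ.filter fun v => P (f v)).card =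
      (Finset.univ.filter P).card * (Finset.univ.filter fun v => f v = 0).card := by
    rw [Finset.card_eq_sum_card_fiberwise (f := f) (t := Finset.univ.filter P)
      (fun v => by simp),
      ← smul_eq_mul, ← Finset.sum_const]
    refine Finset.sum_congr rfl fun w hw => ?_
    rw [← hfiber w, Finset.filter_filter]
    congr 1
    ext v
    simp only [Finset.mem_filter, Finset.mem_univ, true_and] at hw ⊢
    exact ⟨fun h => h.2, fun h => ⟨h ▸ hw, h⟩⟩
  rw [hP, hV]
  ring

lemma prod_five_pow_sub_succ (a : ℕ) :
    ∏ i : Fin (a + 1), (5 ^ (a + 1) - 5 ^ (i : ℕ)) =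
      (5 ^ (a + 1) - 1) * 5 ^ a * ∏ i : Fin a, (5 ^ a - 5 ^ (i : ℕ)) := by
  rw [Fin.prod_univ_succ, mul_assoc]
  congr 1
  have h (i : Fin a) : 5 ^ (a + 1) - 5 ^ ((i.succ : Fin (a + 1)) : ℕ) =
      5 * (5 ^ a - 5 ^ (i : ℕ)) := by
    rw [Fin.val_succ, Nat.mul_sub]
    congr 1 <;> ring
  rw [Finset.prod_congr rfl fun i _ => h i, Finset.prod_mul_distrib]
  simp

/-- A lower bound for the number of invertible matrices over `ZMod 5`. -/
lemma le_prod_five_pow_sub (a : ℕ) :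
    (19 * 5 ^ (a + 1) + 5) * 5 ^ ((a + 1) * (a + 1)) ≤
      25 * 5 ^ (a + 1) * ∏ i : Fin (a + 1), (5 ^ (a + 1) - 5 ^ (i : ℕ)) := by
  induction a with
  | zero => simp
  | succ a ih =>
    rw [prod_five_pow_sub_succ (a + 1)]
    generalize ∏ i : Fin (a + 1), (5 ^ (a + 1) - 5 ^ (i : ℕ)) = N at ih ⊢
    obtain ⟨Q, hQ⟩ : ∃ Q, 5 ^ (a + 1) = Q + 5 :=
      Nat.exists_eq_add_of_le' (Nat.le_self_pow (by omega) 5)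
    have hexp : 5 ^ ((a + 1 + 1) * (a + 1 + 1)) =
        5 ^ ((a + 1) * (a + 1)) * (5 * (5 ^ (a + 1)) ^ 2) := by ring
    rw [hexp, pow_succ 5 (a + 1), hQ]
    generalize 5 ^ ((a + 1) * (a + 1)) = P at ih ⊢
    rw [hQ] at ih
    have hsub : (Q + 5) * 5 - 1 = 5 * Q + 24 := by omega
    rw [hsub]
    calc _ ≤ ((5 * Q + 24) * 5 * (Q + 5)) * ((19 * (Q + 5) + 5) * P) := by
          exact Nat.le.intro (k := P * (5 * (Q + 5) * Q)) (by ring)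
      _ ≤ ((5 * Q + 24) * 5 * (Q + 5)) * (25 * (Q + 5) * N) := Nat.mul_le_mul_left _ ih
      _ = _ := by ring

/-- At most `6/25` of the square matrices over `ZMod 5` of a given size are singular. -/
lemma card_det_eq_zero_le (a : ℕ) :
    25 * (Finset.univ.filter fun A : Matrix (Fin a) (Fin a) (ZMod 5) => A.det = 0).card ≤
      6 * Fintype.card (Matrix (Fin a) (Fin a) (ZMod 5)) := by
  have hGL : ∏ i : Fin a, (5 ^ a - 5 ^ (i : ℕ)) ≤
      (Finset.univ.filter fun A : Matrix (Fin a) (Fin a) (ZMod 5) => ¬A.det = 0).card := by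
    have h := Matrix.card_GL_field (𝔽 := ZMod 5) a
    simp only [ZMod.card] at h
    rw [← h, Nat.card_eq_fintype_card, ← Fintype.card_subtype]
    exact Fintype.card_le_of_injective
      (fun U => ⟨U.1, ((Matrix.isUnit_iff_isUnit_det _).1 U.isUnit).ne_zero⟩)
      fun U V h => Units.ext (congrArg Subtype.val h)
  have hsplit := Finset.card_filter_add_card_filter_not (s := Finset.univ)
    fun A : Matrix (Fin a) (Fin a) (ZMod 5) => A.det = 0
  rw [Finset.card_univ] at hsplit
  have hcard : Fintype.card (Matrix (Fin a) (Fin a) (ZMod 5)) = 5 ^ (a * a) := by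
    exact (Fintype.card_congr Matrix.of.symm).trans (by simp [pow_mul])
  suffices h : 19 * 5 ^ (a * a) ≤ 25 * ∏ i : Fin a, (5 ^ a - 5 ^ (i : ℕ)) by
    rw [← hcard] at h
    omega
  cases a with
  | zero => simp
  | succ a =>
    refine Nat.le_of_mul_le_mul_left ?_ (show 0 < 5 ^ (a + 1) by positivity)
    calc _ ≤ (19 * 5 ^ (a + 1) + 5) * 5 ^ ((a + 1) * (a + 1)) := 
          Nat.le.intro (k := 5 * 5 ^ ((a + 1) * (a + 1))) (by ring)
      _ ≤ _ := le_prod_five_pow_sub a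
      _ = _ := by ring

lemma leadingSubmatrix_surjective {n : ℕ} {K : Type*} [Zero K] (S : Finset (Fin n)) :
    Function.Surjective fun M : Matrix (Fin n) (Fin n) K => leadingSubmatrix M S := by
  intro A
  let B (p : Fin S.card) : Fin n → K :=
    Function.extend (Fin.castLE (card_finset_fin_le S)) (A p) 0
  refine ⟨Matrix.of (Function.extend (S.orderEmbOfFin rfl) B 0), ?_⟩
  ext p q
  simp only [leadingSubmatrix, Matrix.submatrix_apply, Matrix.of_apply]
  rw [(S.orderEmbOfFin rfl).injective.extend_apply]
  exact (Fin.castLE_injective _).extend_apply _ _ q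

lemma card_det_leadingSubmatrix_eq_zero_le {n : ℕ} (S : Finset (Fin n)) :
    25 * (Finset.univ.filter fun M : Matrix (Fin n) (Fin n) (ZMod 5) =>
      (leadingSubmatrix M S).det = 0).card ≤
      6 * Fintype.card (Matrix (Fin n) (Fin n) (ZMod 5)) := by
  have h := card_filter_comp_mul_card
    (AddMonoidHom.mk' (fun M : Matrix (Fin n) (Fin n) (ZMod 5) => leadingSubmatrix M S)
      fun _ _ => rfl) (leadingSubmatrix_surjective S) fun A => A.det = 0
  refine Nat.le_of_mul_le_mul_right ?_
    (Fintype.card_pos (α := Matrix (Fin S.card) (Fin S.card) (ZMod 5)))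
  calc _ = 25 * (_ * Fintype.card (Matrix (Fin S.card) (Fin S.card) (ZMod 5))) := mul_assoc _ _ _
    _ = _ := congrArg (25 * ·) h
    _ = _ := (mul_assoc _ _ _).symm
    _ ≤ _ := Nat.mul_le_mul_right _ (card_det_eq_zero_le S.card)
    _ = _ := by ring

/-- The sets `S` with `#S` congruent to `s` or `s + 1` modulo `4` whose leading submatrix of `M`
is singular. -/
def singularSets (n : ℕ) (s : ZMod 4) (M : Matrix (Fin n) (Fin n) (ZMod 5)) :
    Finset (Finset (Fin n)) :=
  Finset.univ.filter fun S =>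
    ((S.card : ZMod 4) = s ∨ (S.card : ZMod 4) = s + 1) ∧ (leadingSubmatrix M S).det = 0

lemma isHitting_singularSets (n : ℕ) (s : ZMod 4) (M : Matrix (Fin n) (Fin n) (ZMod 5)) :
    IsHitting n 6 (singularSets n s M) := by
  intro X Y hX hXY
  obtain ⟨k, hk, hs⟩ : ∃ k ∈ ({1, 2, 3, 4} : Finset ℕ), ((Y.card : ZMod 4) + k) = s := by
    generalize (Y.card : ZMod 4) = y
    revert s y
    decide
  obtain ⟨A, hAX, hA, hdet⟩ :
      ∃ A ⊆ X, (A.card = k ∨ A.card = k + 1) ∧ (leadingSubmatrix M (Y ∪ A)).det = 0 := by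
    have hk' : (k = 1 ∨ k = 2) ∨ k = 3 ∨ k = 4 := by simpa [or_assoc] using hk
    exact hk'.elim (exists_det_eq_zero_of_small hX hXY) (exists_det_eq_zero_of_large hX hXY)
  refine ⟨A, hAX, Finset.mem_filter.2 ⟨Finset.mem_univ _, ?_, hdet⟩⟩
  rw [Finset.card_union_of_disjoint (hXY.symm.mono_right hAX), ← hs]
  obtain hA | hA := hA <;> simp [hA, add_assoc]

lemma sum_card_singularSets_le (n : ℕ) :
    25 * ∑ p : ZMod 4 × Matrix (Fin n) (Fin n) (ZMod 5), (singularSets n p.1 p.2).card ≤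
      12 * 2 ^ n * Fintype.card (Matrix (Fin n) (Fin n) (ZMod 5)) := by
  have hres (S : Finset (Fin n)) : (Finset.univ.filter fun s : ZMod 4 =>
      (S.card : ZMod 4) = s ∨ (S.card : ZMod 4) = s + 1).card = 2 := by
    generalize (S.card : ZMod 4) = y
    revert y
    decide
  have hswap : ∑ p : ZMod 4 × Matrix (Fin n) (Fin n) (ZMod 5), (singularSets n p.1 p.2).card =
      ∑ S : Finset (Fin n), 2 * (Finset.univ.filter fun M : Matrix (Fin n) (Fin n) (ZMod 5) =>
        (leadingSubmatrix M S).det = 0).card := by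
    refine (Finset.sum_card_bipartiteAbove_eq_sum_card_bipartiteBelow
      fun (p : ZMod 4 × Matrix (Fin n) (Fin n) (ZMod 5)) (S : Finset (Fin n)) =>
        ((S.card : ZMod 4) = p.1 ∨ (S.card : ZMod 4) = p.1 + 1) ∧
          (leadingSubmatrix p.2 S).det = 0).trans (Finset.sum_congr rfl fun S _ => ?_)
    rw [← hres S, ← Finset.card_product, ← Finset.filter_product, Finset.univ_product_univ]
    rfl
  rw [hswap, Finset.mul_sum]
  calc _ ≤ ∑ S : Finset (Fin n), 12 * Fintype.card (Matrix (Fin n) (Fin n) (ZMod 5)) := by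
        refine Finset.sum_le_sum fun S _ => ?_
        have := card_det_leadingSubmatrix_eq_zero_le S
        omega
    _ = _ := by
        simp only [Finset.sum_const, Finset.card_univ, Fintype.card_finset, Fintype.card_fin,
          smul_eq_mul]
        ring

lemma exists_isHitting_card_le (n : ℕ) :
    ∃ G : Finset (Finset (Fin n)), IsHitting n 6 G ∧ 25 * G.card ≤ 3 * 2 ^ n := by
  obtain ⟨p, -, hp⟩ := Finset.exists_le_of_sum_le
    (s := (Finset.univ : Finset (ZMod 4 × Matrix (Fin n) (Fin n) (ZMod 5))))
    (f := fun p => 25 * (singularSets n p.1 p.2).card) (g := fun _ => 3 * 2 ^ n)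
    Finset.univ_nonempty (by
      rw [← Finset.mul_sum]
      refine (sum_card_singularSets_le n).trans (le_of_eq ?_)
      simp only [Finset.sum_const, Finset.card_univ, Fintype.card_prod, ZMod.card, smul_eq_mul]
      ring)
  exact ⟨_, isHitting_singularSets n p.1 p.2, hp⟩

/-- For every positive integer `n`, `g(n,6) ≤ (3/25)·2^n`: there is a `Q_6`-hitting set
in `Q_n` of size at most `0.12·2^n`. -/
theorem g_n_six_le (n : ℕ) (hn : 0 < n) :
    (g n 6 : ℝ) ≤ (3 / 25) * 2 ^ n ∧
    ∃ G : Finset (Finset (Fin n)), IsHitting n 6 G ∧ (G.card : ℝ) ≤ (3 / 25) * 2 ^ n := by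
  obtain ⟨G, hG, hcard⟩ := exists_isHitting_card_le n
  have hreal : (G.card : ℝ) ≤ 3 / 25 * 2 ^ n := by
    have : (25 * G.card : ℝ) ≤ 3 * 2 ^ n := by exact_mod_cast hcard
    linarith
  refine ⟨le_trans ?_ hreal, G, hG, hreal⟩
  have hg : g n 6 ≤ G.card := Nat.sInf_le ⟨G, hG, rfl⟩
  exact_mod_cast hg
end

section
/- Let n ≥ r ≥ 1 be integers. Then there exist families F_1 of r-element subsets of [n] and F_2 of (r−1)-element subsets of [n] such that F_1 ∪ F_2 does not contain a copy of the layers i and i−1 of a Q_6 for any 2 ≤ i ≤ 5, and |F_1|/C(n,r) + |F_2|/C(n,r−1) > 1.52. -/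
/-- `F` contains a copy of the layers `i` and `i-1` of a `Q_6` (for some `2 ≤ i ≤ 5`),
inside the layers `r-1` and `r` of the power set of the ground type: there are `X` of size 6
and `Y` disjoint from `X` with `|Y| = r - i`, such that `Y ∪ A ∈ F` for every
`A ⊆ X` with `|A| = i - 1` or `|A| = i`. -/
def ContainsQ6Layers {α : Type*} [DecidableEq α] (r : ℕ) (F : Finset (Finset α)) : Prop :=
  ∃ i : ℕ, 2 ≤ i ∧ i ≤ 5 ∧
    ∃ X Y : Finset α, X.card = 6 ∧ Disjoint X Y ∧ Y.card + i = r ∧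
      (∀ A ⊆ X, A.card = i - 1 → Y ∪ A ∈ F) ∧
      (∀ A ⊆ X, A.card = i → Y ∪ A ∈ F)

/-- Two rows without vanishing entries or minors have injective ratios. -/
lemma ratio_image {ι κ : Type*} {M : ι → κ → ZMod 5} {R : Finset ι} {C : Finset κ}
    (h0 : ∀ a ∈ R, ∀ j ∈ C, M a j ≠ 0)
    (h2 : ∀ a ∈ R, ∀ b ∈ R, a ≠ b → ∀ j ∈ C, ∀ k ∈ C, j ≠ k → M a j * M b k ≠ M a k * M b j)
    {a b : ι} (ha : a ∈ R) (hb : b ∈ R) (hab : a ≠ b) :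
    Set.InjOn (fun j => M a j / M b j) C ∧
      Set.MapsTo (fun j => M a j / M b j) C (Finset.univ.erase (0 : ZMod 5) : Finset (ZMod 5)) := by
  refine ⟨fun j hj k hk hjk => ?_, fun j hj => ?_⟩
  · by_contra hne
    refine h2 a ha b hb hab j hj k hk hne ?_
    have := h0 b hb j hj
    have := h0 b hb k hk
    simp only at hjk
    field_simp at hjk
    linear_combination hjk
  · simp [div_ne_zero (h0 a ha j hj) (h0 b hb j hj)]

lemma card_columns_le_four {ι κ : Type*} {M : ι → κ → ZMod 5} {R : Finset ι} {C : Finset κ}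
    (h0 : ∀ a ∈ R, ∀ j ∈ C, M a j ≠ 0)
    (h2 : ∀ a ∈ R, ∀ b ∈ R, a ≠ b → ∀ j ∈ C, ∀ k ∈ C, j ≠ k → M a j * M b k ≠ M a k * M b j)
    (hR : 2 ≤ R.card) : C.card ≤ 4 := by
  obtain ⟨a, ha, b, hb, hab⟩ := Finset.one_lt_card.1 hR
  obtain ⟨hi, hm⟩ := ratio_image h0 h2 ha hb hab
  have := Finset.card_le_card_of_injOn _ hm hi
  simpa using this

lemma card_columns_ne_four {ι κ : Type*} {M : ι → κ → ZMod 5} {R : Finset ι} {C : Finset κ}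
    (h0 : ∀ a ∈ R, ∀ j ∈ C, M a j ≠ 0)
    (h2 : ∀ a ∈ R, ∀ b ∈ R, a ≠ b → ∀ j ∈ C, ∀ k ∈ C, j ≠ k → M a j * M b k ≠ M a k * M b j)
    (hR : 3 ≤ R.card) : C.card ≠ 4 := by
  intro hC
  obtain ⟨a, b, c, ha, hb, hc, hab, hac, hbc⟩ := Finset.two_lt_card_iff.1 hR
  have key : ∀ {x y : ι}, x ∈ R → y ∈ R → x ≠ y → ∏ j ∈ C, M x j / M y j = -1 := by
    intro x y hx hy hxy
    obtain ⟨hi, hm⟩ := ratio_image h0 h2 hx hy hxy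
    have himg : C.image (fun j => M x j / M y j) = Finset.univ.erase 0 := by
      refine Finset.eq_of_subset_of_card_le (Finset.image_subset_iff.2 hm) ?_
      rw [Finset.card_image_of_injOn hi, hC]
      simp
    rw [← Finset.prod_image (f := fun z : ZMod 5 => z) hi, himg]
    decide
  have hmul : (∏ j ∈ C, M a j / M b j) * ∏ j ∈ C, M b j / M c j = ∏ j ∈ C, M a j / M c j := by
    rw [← Finset.prod_mul_distrib]
    refine Finset.prod_congr rfl fun j hj => ?_
    have := h0 b hb j hj
    field_simp
  rw [key ha hb hab, key hb hc hbc, key ha hc hac] at hmul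
  exact absurd hmul (by decide)

/-- Over `𝔽₅` there are no seven vectors in general position in dimension `2 ≤ i ≤ 5`, even
after factoring out `v '' Y`. -/
theorem no_seven_arc {ι V : Type*} [DecidableEq ι] [AddCommGroup V] [Module (ZMod 5) V]
    {v : ι → V} {X Y : Finset ι} {i : ℕ} (hi2 : 2 ≤ i) (hi5 : i ≤ 5) (hX : X.card = 7)
    (hXY : Disjoint X Y) (hV : Y.card + i = Module.finrank (ZMod 5) V)
    (h : ∀ S ⊆ X, S.card = i → LinearIndepOn (ZMod 5) v (Y ∪ S : Finset ι)) : False := by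
  obtain ⟨R, hRX, hR⟩ := Finset.exists_subset_card_eq (show i ≤ X.card by omega)
  have hB := h R hRX hR
  have hYR : Disjoint R Y := hXY.mono_left hRX
  obtain ⟨f, hf⟩ : ∃ f : ι → V →ₗ[ZMod 5] ZMod 5, ∀ x, x = ∑ c ∈ Y ∪ R, f c x • v c := by
    have : FiniteDimensional (ZMod 5) V := FiniteDimensional.of_finrank_pos (by omega)
    let b := basisOfLinearIndependentOfCardEqFinrank' (fun c : (Y ∪ R : Finset ι) => v c) hB (by
      rw [Fintype.card_coe, Finset.card_union_of_disjoint hYR.symm, hR, hV])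
    refine ⟨fun c => if hc : c ∈ Y ∪ R then b.coord ⟨c, hc⟩ else 0, fun x => ?_⟩
    rw [← Finset.sum_coe_sort]
    have hb : ∀ c, b c = v c := fun c =>
      congrFun (coe_basisOfLinearIndependentOfCardEqFinrank' _ hB _) c
    conv_lhs => rw [← b.sum_repr x]
    refine Finset.sum_congr rfl fun c _ => ?_
    simp [hb]
  have hspan : ∀ (T : Finset ι) (x : V), (∀ c ∈ R, c ∉ T → f c x = 0) → Y ⊆ T →
      x ∈ Submodule.span (ZMod 5) (v '' T) := by
    intro T x hx hY
    rw [hf x]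
    refine Submodule.sum_mem _ fun c hc => ?_
    by_cases hcT : c ∈ T
    · exact Submodule.smul_mem _ _ (Submodule.subset_span ⟨c, hcT, rfl⟩)
    · have hcR : c ∈ R := (Finset.mem_union.1 hc).resolve_left fun h => hcT (hY h)
      simp [hx c hcR hcT]
  have h0 : ∀ a ∈ R, ∀ j ∈ X \ R, f a (v j) ≠ 0 := by
    intro a ha j hj hz
    obtain ⟨hjX, hjR⟩ := Finset.mem_sdiff.1 hj
    have hjY : j ∉ Y := Finset.disjoint_left.1 hXY hjX
    have hli := h (insert j (R.erase a))
      (Finset.insert_subset hjX ((Finset.erase_subset _ _).trans hRX)) (by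
        rw [Finset.card_insert_of_notMem (by simp [hjR]), Finset.card_erase_of_mem ha]; omega)
    rw [Finset.union_insert, Finset.coe_insert] at hli
    refine hli.notMem_span_of_insert (by simp [hjR, hjY]) (hspan _ _ ?_ Finset.subset_union_left)
    intro c hc hcT
    obtain rfl : c = a := by
      by_contra hne
      exact hcT (by simp [hne, hc])
    exact hz
  have h2 : ∀ a ∈ R, ∀ b ∈ R, a ≠ b → ∀ j ∈ X \ R, ∀ k ∈ X \ R, j ≠ k →
      f a (v j) * f b (v k) ≠ f a (v k) * f b (v j) := by
    intro a ha b hb hab j hj k hk hjk heq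
    have hk0 := h0 a ha k hk
    obtain ⟨hjX, hjR⟩ := Finset.mem_sdiff.1 hj
    obtain ⟨hkX, hkR⟩ := Finset.mem_sdiff.1 hk
    have hjY : j ∉ Y := Finset.disjoint_left.1 hXY hjX
    have hli := h (insert j (insert k ((R.erase a).erase b)))
      (Finset.insert_subset hjX (Finset.insert_subset hkX
        ((Finset.erase_subset _ _).trans ((Finset.erase_subset _ _).trans hRX)))) (by
        rw [Finset.card_insert_of_notMem (by simp [hjR, hjk]),
          Finset.card_insert_of_notMem (by simp [hkR]),
          Finset.card_erase_of_mem (by simp [hb, hab.symm]), Finset.card_erase_of_mem ha]; omega)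
    rw [Finset.union_insert, Finset.coe_insert] at hli
    refine hli.notMem_span_of_insert (by simp [hjR, hjY, hjk]) ?_
    have hmem := hspan (Y ∪ insert k ((R.erase a).erase b))
      (v j - (f a (v j) / f a (v k)) • v k) (fun c hc hcT => ?_) Finset.subset_union_left
    · rw [← sub_add_cancel (v j) ((f a (v j) / f a (v k)) • v k)]
      exact Submodule.add_mem _ hmem
        (Submodule.smul_mem _ _ (Submodule.subset_span ⟨k, by simp, rfl⟩))
    · have : c = a ∨ c = b := by
        by_contra! hne
        exact hcT (by simp [hne, hc])
      rw [map_sub, map_smul, smul_eq_mul]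
      rcases this with rfl | rfl
      · field_simp; ring
      · field_simp; linear_combination -heq
  have hC : (X \ R).card = 7 - i := by rw [Finset.card_sdiff_of_subset hRX, hX, hR]
  have h0' : ∀ j ∈ X \ R, ∀ a ∈ R, f a (v j) ≠ 0 := fun j hj a ha => h0 a ha j hj
  have h2' : ∀ j ∈ X \ R, ∀ k ∈ X \ R, j ≠ k → ∀ a ∈ R, ∀ b ∈ R, a ≠ b →
      f a (v j) * f b (v k) ≠ f b (v j) * f a (v k) := fun j hj k hk hjk a ha b hb hab he =>
    h2 a ha b hb hab j hj k hk hjk (by rw [he, mul_comm])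
  have c1 := card_columns_le_four h0 h2 (by omega)
  have c2 := card_columns_le_four (M := fun j a => f a (v j)) h0' h2' (by omega)
  have c3 := card_columns_ne_four h0 h2
  have c4 := card_columns_ne_four (M := fun j a => f a (v j)) h0' h2'
  rcases (by omega : i = 3 ∨ i = 4) with rfl | rfl
  · exact c3 (by omega) (by omega)
  · exact c4 (by omega) (by omega)

/-- Adjoining a vector in the kernel of the projection to an independent family. -/
lemma linearIndepOn_insert_none {ι K W : Type*} [Field K] [AddCommGroup W] [Module K W]
    {v : ι → K × W} {A : Set ι} (h : LinearIndepOn K (Prod.snd ∘ v) A) :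
    LinearIndepOn K (fun o : Option ι => o.elim (1, 0) v) (insert none (some '' A)) := by
  have hv : LinearIndepOn K v A := LinearIndependent.of_comp (LinearMap.snd K K W) h
  rw [linearIndepOn_insert (by simp)]
  refine ⟨hv.image_of_comp some (fun o : Option ι => o.elim (1, 0) v), fun hmem => ?_⟩
  rw [← Set.image_comp, Finsupp.mem_span_image_iff_linearCombination] at hmem
  obtain ⟨l, hl, hlw⟩ := hmem
  have hl0 : l = 0 := by
    refine linearIndepOn_iff.1 h l hl ?_
    have := congrArg (LinearMap.snd K K W) hlw
    rwa [Finsupp.apply_linearCombination] at this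
  simp [hl0, Prod.ext_iff] at hlw

/-- The probability that a uniformly random square matrix of size `k` over `𝔽₅` is invertible. -/
noncomputable def invertibleProb (k : ℕ) : ℝ := ∏ j ∈ Finset.range k, (1 - (1 / 5 : ℝ) ^ (j + 1))

lemma lt_invertibleProb (k : ℕ) : 0.76 < invertibleProb k := by
  have hstep : ∀ m, invertibleProb (m + 1) = invertibleProb m * (1 - (1 / 5 : ℝ) ^ (m + 1)) :=
    fun m => Finset.prod_range_succ _ _
  have hlarge : ∀ m, 0.76 * (1 + (1 / 5 : ℝ) ^ (m + 4) / 2) ≤ invertibleProb (m + 4) := by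
    intro m
    induction m with
    | zero => norm_num [invertibleProb, Finset.prod_range_succ]
    | succ m ih =>
      rw [show m + 1 + 4 = m + 4 + 1 by ring, hstep]
      set x : ℝ := (1 / 5 : ℝ) ^ (m + 4) with hx
      have hx0 : 0 < x := by positivity
      have hx1 : x ≤ 1 := pow_le_one₀ (by norm_num) (by norm_num)
      rw [pow_succ, ← hx]
      refine le_trans ?_ (mul_le_mul_of_nonneg_right ih (by linarith))
      nlinarith
  rcases lt_or_ge k 4 with hk | hk
  · interval_cases k <;> norm_num [invertibleProb, Finset.prod_range_succ]
  · obtain ⟨m, rfl⟩ := Nat.exists_eq_add_of_le' hk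
    refine lt_of_lt_of_le ?_ (hlarge m)
    have : (0 : ℝ) < (1 / 5 : ℝ) ^ (m + 4) := by positivity
    linarith

open Classical in
/-- The number of vector configurations for which a given set of `finrank` many indices
spans. -/
lemma card_filter_linearIndepOn {α V : Type*} [Fintype α] [DecidableEq α] [AddCommGroup V]
    [Module (ZMod 5) V] [Fintype V] {A : Finset α} (hA : A.card = Module.finrank (ZMod 5) V) :
    ((Finset.univ.filter fun v : α → V => LinearIndepOn (ZMod 5) v (A : Set α)).card : ℝ) =
      Fintype.card (α → V) * invertibleProb A.card := by
  set d := A.card with hd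
  have hV : Fintype.card V = 5 ^ d := by
    rw [Module.card_eq_pow_finrank (K := ZMod 5), ZMod.card, hA]
  have hsq : (Fintype.card {s : A → V // LinearIndependent (ZMod 5) s} : ℝ) =
      Fintype.card (A → V) * invertibleProb d := by
    have e : {s : A → V // LinearIndependent (ZMod 5) s} ≃
        {s : Fin d → V // LinearIndependent (ZMod 5) s} :=
      (Equiv.arrowCongr A.equivFin (Equiv.refl V)).subtypeEquiv fun s =>
        (linearIndependent_equiv A.equivFin.symm).symm
    rw [Fintype.card_congr e, ← Nat.card_eq_fintype_card, card_linearIndependent hA.le, ← hA,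
      ZMod.card, Fintype.card_fun, hV, Fintype.card_coe, ← hd, invertibleProb,
      ← Fin.prod_univ_eq_prod_range (fun j => 1 - (1 / 5 : ℝ) ^ (j + 1)), ← Equiv.prod_comp Fin.revPerm]
    have hconst : (((5 ^ d) ^ d : ℕ) : ℝ) = ∏ _j : Fin d, (5 : ℝ) ^ d := by simp
    rw [hconst, Nat.cast_prod, ← Finset.prod_mul_distrib]
    refine Finset.prod_congr rfl fun j _ => ?_
    have hj := j.2
    rw [Nat.cast_sub (Nat.pow_le_pow_right (by norm_num) (by simp))]
    push_cast
    simp only [Fin.revPerm_apply, Fin.val_rev]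
    have h5 : (5 : ℝ) ^ d = 5 ^ (d - (j + 1)) * 5 ^ (j + 1 : ℕ) := by
      rw [← pow_add]; congr 1; omega
    rw [h5, one_div, inv_pow]
    field_simp
  let e := Equiv.piEquivPiSubtypeProd (· ∈ A) (fun _ : α => V)
  have hmap : (Finset.univ.filter fun v : α → V =>
      LinearIndepOn (ZMod 5) v (A : Set α)).map e.toEmbedding =
      (Finset.univ.filter fun s : A → V => LinearIndependent (ZMod 5) s) ×ˢ Finset.univ := by
    ext ⟨s, t⟩
    obtain ⟨v, hv⟩ := e.surjective (s, t)
    simp only [Finset.mem_map_equiv, Finset.mem_filter, Finset.mem_product, Finset.mem_univ,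
      true_and, and_true]
    rw [← hv, e.symm_apply_apply, show s = fun a : A => v a from (congrArg Prod.fst hv).symm]
    exact Iff.rfl
  rw [← Finset.card_map, hmap, Finset.card_product, ← Fintype.card_subtype, Nat.cast_mul, hsq,
    Fintype.card_congr e, Fintype.card_prod, Nat.cast_mul, Finset.card_univ]
  ring

open Classical in
lemma card_filter_linearIndepOn_snd {α W : Type*} [Fintype α] [DecidableEq α] [AddCommGroup W]
    [Module (ZMod 5) W] [Fintype W] {A : Finset α} (hA : A.card = Module.finrank (ZMod 5) W) :
    ((Finset.univ.filter fun v : α → ZMod 5 × W =>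
      LinearIndepOn (ZMod 5) (Prod.snd ∘ v) (A : Set α)).card : ℝ) =
      Fintype.card (α → ZMod 5 × W) * invertibleProb A.card := by
  let e := Equiv.arrowProdEquivProdArrow α (fun _ => ZMod 5) (fun _ => W)
  have hmap : (Finset.univ.filter fun v : α → ZMod 5 × W =>
      LinearIndepOn (ZMod 5) (Prod.snd ∘ v) (A : Set α)).map e.toEmbedding =
      Finset.univ ×ˢ Finset.univ.filter fun u : α → W =>
        LinearIndepOn (ZMod 5) u (A : Set α) := by
    ext ⟨g, u⟩
    simp only [Finset.mem_map_equiv, Finset.mem_filter, Finset.mem_product, Finset.mem_univ,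
      true_and]
    exact Iff.rfl
  rw [← Finset.card_map, hmap, Finset.card_product, Nat.cast_mul, card_filter_linearIndepOn hA,
    Fintype.card_congr e, Fintype.card_prod, Nat.cast_mul, Finset.card_univ]
  ring

/-- Averaging: if every `k`-set is good for a proportion `p` of the parameters, then the densities
of the good families sum to `p` times the number of parameters. -/
lemma sum_density_eq {Ω : Type*} [Fintype Ω] {n k : ℕ} (hk : k ≤ n) {p : ℝ}
    (P : Ω → Finset (Fin n) → Prop) [∀ v A, Decidable (P v A)]
    (hP : ∀ A : Finset (Fin n), A.card = k →
      ((Finset.univ.filter fun v => P v A).card : ℝ) = Fintype.card Ω * p) :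
    ∑ v, (((Finset.univ.powersetCard k).filter (P v)).card : ℝ) / (n.choose k : ℝ) =
      Fintype.card Ω * p := by
  have hpos : (0 : ℝ) < n.choose k := by exact_mod_cast Nat.choose_pos hk
  have hswap : ∑ v, (((Finset.univ.powersetCard k).filter (P v)).card : ℝ) =
      ∑ A ∈ (Finset.univ : Finset (Fin n)).powersetCard k,
        ((Finset.univ.filter fun v => P v A).card : ℝ) := by
    simp only [Finset.card_filter, Nat.cast_sum]
    exact Finset.sum_comm
  rw [← Finset.sum_div, hswap,
    Finset.sum_congr rfl fun A hA => hP A (Finset.mem_powersetCard.1 hA).2]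
  simp only [Finset.sum_const, Finset.card_powersetCard, Finset.card_univ, Fintype.card_fin,
    nsmul_eq_mul]
  field_simp

/-- A configuration of vectors gives no copy of two layers of `Q_6`. -/
lemma not_containsQ6Layers {α W : Type*} [DecidableEq α] [AddCommGroup W] [Module (ZMod 5) W]
    [FiniteDimensional (ZMod 5) W] {v : α → ZMod 5 × W} {F₁ F₂ : Finset (Finset α)}
    (h₁ : ∀ A ∈ F₁, A.card = Module.finrank (ZMod 5) W + 1 ∧
      LinearIndepOn (ZMod 5) v (A : Set α))
    (h₂ : ∀ A ∈ F₂, A.card = Module.finrank (ZMod 5) W ∧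
      LinearIndepOn (ZMod 5) (Prod.snd ∘ v) (A : Set α)) :
    ¬ ContainsQ6Layers (Module.finrank (ZMod 5) W + 1) (F₁ ∪ F₂) := by
  rintro ⟨i, hi2, hi5, X, Y, hX, hXY, hYi, hlow, hhigh⟩
  have hcard : ∀ A ⊆ X, (Y ∪ A).card = Y.card + A.card := fun A hA =>
    Finset.card_union_of_disjoint (hXY.mono_left hA).symm
  refine no_seven_arc (v := fun o : Option α => o.elim (1, 0) v) (X := X.insertNone)
    (Y := Y.map Function.Embedding.some) hi2 hi5 (by simp [hX]) ?_ ?_ ?_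
  · rw [Finset.disjoint_left]
    rintro (_ | x) hx hy
    · simp at hy
    · exact Finset.disjoint_left.1 hXY (by simpa using hx) (by simpa using hy)
  · rw [Finset.card_map, hYi, Module.finrank_prod, Module.finrank_self, add_comm]
  · intro S hS hSi
    have hAX : S.eraseNone ⊆ X := fun x hx =>
      Finset.some_mem_insertNone.1 (hS (Finset.mem_eraseNone.1 hx))
    by_cases hnone : none ∈ S
    · have hAc : S.eraseNone.card = i - 1 := by
        rw [Finset.card_eraseNone_of_mem hnone, hSi]
      have hF : Y ∪ S.eraseNone ∈ F₂ := by
        refine (Finset.mem_union.1 (hlow _ hAX hAc)).resolve_left fun h => ?_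
        have := (h₁ _ h).1
        rw [hcard _ hAX] at this
        omega
      refine (linearIndepOn_insert_none (h₂ _ hF).2).mono ?_
      rintro (_ | x) hx
      · exact Set.mem_insert _ _
      · simpa using hx
    · have hSA : S = S.eraseNone.map Function.Embedding.some := by
        ext (_ | x) <;> simp [hnone]
      have hAc : S.eraseNone.card = i := by
        rw [Finset.card_eraseNone_of_not_mem hnone, hSi]
      have hF : Y ∪ S.eraseNone ∈ F₁ := by
        refine (Finset.mem_union.1 (hhigh _ hAX hAc)).resolve_right fun h => ?_
        have := (h₂ _ h).1
        rw [hcard _ hAX] at this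
        omega
      rw [hSA, ← Finset.map_union, Finset.coe_map]
      exact (h₁ _ hF).2.image_of_comp some (fun o : Option α => o.elim (1, 0) v)

open Classical in
/-- Some configuration of `n` vectors gives two families of large total density. -/
lemma exists_dense_configuration {W : Type*} [AddCommGroup W] [Module (ZMod 5) W] [Fintype W]
    {n m : ℕ} (hW : Module.finrank (ZMod 5) W = m) (hn : m + 1 ≤ n) :
    ∃ v : Fin n → ZMod 5 × W, (1.52 : ℝ) <
      (((Finset.univ.powersetCard (m + 1)).filter fun A : Finset (Fin n) =>
        LinearIndepOn (ZMod 5) v (A : Set (Fin n))).card : ℝ) / (n.choose (m + 1) : ℝ) +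
      (((Finset.univ.powersetCard m).filter fun A : Finset (Fin n) =>
        LinearIndepOn (ZMod 5) (Prod.snd ∘ v) (A : Set (Fin n))).card : ℝ) / (n.choose m : ℝ) := by
  have hV : Module.finrank (ZMod 5) (ZMod 5 × W) = m + 1 := by
    rw [Module.finrank_prod, Module.finrank_self, hW, add_comm]
  have hs₁ := sum_density_eq hn
    (fun (v : Fin n → ZMod 5 × W) A => LinearIndepOn (ZMod 5) v (A : Set (Fin n)))
    (p := invertibleProb (m + 1))
    fun A hA => by rw [card_filter_linearIndepOn (hA.trans hV.symm), hA]
  have hs₂ := sum_density_eq (show m ≤ n by omega)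
    (fun (v : Fin n → ZMod 5 × W) A => LinearIndepOn (ZMod 5) (Prod.snd ∘ v) (A : Set (Fin n)))
    (p := invertibleProb m)
    fun A hA => by rw [card_filter_linearIndepOn_snd (hA.trans hW.symm), hA]
  have hΩ : (0 : ℝ) < Fintype.card (Fin n → ZMod 5 × W) := by exact_mod_cast Fintype.card_pos
  have hm := lt_invertibleProb m
  have hm' := lt_invertibleProb (m + 1)
  by_contra! hle
  have hsum := Finset.sum_le_sum fun v (_ : v ∈ Finset.univ) => hle v
  rw [Finset.sum_add_distrib, hs₁, hs₂, Finset.sum_const, nsmul_eq_mul, Finset.card_univ,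
    ← mul_add] at hsum
  linarith [le_of_mul_le_mul_left hsum hΩ]

/-- For `n ≥ r ≥ 1` there are families `F_1 ⊆ [n]^(r)` and `F_2 ⊆ [n]^(r-1)` such that
`F_1 ∪ F_2` contains no copy of two consecutive nontrivial layers of a `Q_6`, and
`|F_1|/C(n,r) + |F_2|/C(n,r-1) > 1.52`. -/
theorem two_layers_dense_family (n r : ℕ) (hr : 1 ≤ r) (hn : r ≤ n) :
    ∃ F₁ F₂ : Finset (Finset (Fin n)),
      (∀ A ∈ F₁, A.card = r) ∧ (∀ A ∈ F₂, A.card = r - 1) ∧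
      ¬ ContainsQ6Layers r (F₁ ∪ F₂) ∧
      (F₁.card : ℝ) / (n.choose r : ℝ) + (F₂.card : ℝ) / (n.choose (r - 1) : ℝ) > 1.52 := by
  classical
  obtain ⟨m, rfl⟩ := Nat.exists_eq_add_of_le' hr
  rw [Nat.add_sub_cancel]
  have hW : Module.finrank (ZMod 5) (Fin m → ZMod 5) = m := by simp
  obtain ⟨v, hv⟩ := exists_dense_configuration hW hn
  refine ⟨_, _, fun A hA => ?_, fun A hA => ?_, ?_, hv⟩
  · exact (Finset.mem_powersetCard.1 (Finset.mem_filter.1 hA).1).2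
  · exact (Finset.mem_powersetCard.1 (Finset.mem_filter.1 hA).1).2
  · conv => enter [1, 1]; rw [← hW]
    refine not_containsQ6Layers (v := v) (fun A hA => ?_) (fun A hA => ?_)
    all_goals
      rw [hW]
      obtain ⟨hA, hli⟩ := Finset.mem_filter.1 hA
      exact ⟨(Finset.mem_powersetCard.1 hA).2, hli⟩
end
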